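/- arXiv:2304.03814 — 4 statements merged into one kernel-verified Lean document; each statement's English description precedes it below -/
import Mathlib

section
/- Let F and G be noetherian forms over the same category such that a morphism is a G-embedding if and only if it is an F-embedding, and a morphism is a G-quotient if and only if it is an F-quotient. If G has an exact join decomposition, then G is isomorphic to a subform of F. -/
open CategoryTheory

universe w v u

/-- A form over a category `C`, presented as a cluster system:
clusters per object and relations `B ≥_f A` (written `Rel f A B`),
satisfying (F1)-(F3). -/
structure Form (C : Type u) [Category.{v} C] where
  Cl : C → Type w
  Rel : ∀ {X Y : C}, (X ⟶ Y) → Cl X → Cl Y → Prop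
  rel_id : ∀ {X : C} (A : Cl X), Rel (𝟙 X) A A
  rel_comp : ∀ {X Y Z : C} {f : X ⟶ Y} {g : Y ⟶ Z} {A : Cl X} {B : Cl Y} {D : Cl Z},
      Rel f A B → Rel g B D → Rel (f ≫ g) A D
  rel_antisymm : ∀ {X : C} {A B : Cl X}, Rel (𝟙 X) A B → Rel (𝟙 X) B A → A = B

namespace Form

variable {C : Type u} [Category.{v} C]

/-- The fibre order on clusters. -/
def le (F : Form C) {X : C} (A B : F.Cl X) : Prop := F.Rel (𝟙 X) A B

/-- `S` is the image of `f`, i.e. the direct image of the top cluster of the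
domain of `f` along `f`. -/
def IsImageOf (F : Form C) {W X : C} (S : F.Cl X) (f : W ⟶ X) : Prop :=
  ∃ t : F.Cl W, (∀ A : F.Cl W, F.le A t) ∧ F.Rel f t S ∧ ∀ T : F.Cl X, F.Rel f t T → F.le S T

/-- `S` is the kernel of `g`, i.e. the inverse image of the bottom cluster of the
codomain of `g` along `g`. -/
def IsKernelOf (F : Form C) {X Y : C} (S : F.Cl X) (g : X ⟶ Y) : Prop :=
  ∃ b : F.Cl Y, (∀ A : F.Cl Y, F.le b A) ∧ F.Rel g S b ∧ ∀ T : F.Cl X, F.Rel g T b → F.le T S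

/-- A cluster is conormal when it is an image of some morphism. -/
def ConormalCl (F : Form C) {X : C} (S : F.Cl X) : Prop :=
  ∃ (W : C) (f : W ⟶ X), F.IsImageOf S f

/-- A cluster is normal when it is a kernel of some morphism. -/
def NormalCl (F : Form C) {X : C} (S : F.Cl X) : Prop :=
  ∃ (Y : C) (g : X ⟶ Y), F.IsKernelOf S g

/-- A form is conormal when every cluster is conormal. -/
def IsConormal (F : Form C) : Prop := ∀ (X : C) (S : F.Cl X), F.ConormalCl S

/-- A form is normal when every cluster is normal. -/
def IsNormal (F : Form C) : Prop := ∀ (X : C) (S : F.Cl X), F.NormalCl S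

def IsJoinOf (F : Form C) {X : C} (A B J : F.Cl X) : Prop :=
  F.le A J ∧ F.le B J ∧ ∀ D : F.Cl X, F.le A D → F.le B D → F.le J D

def IsMeetOf (F : Form C) {X : C} (A B M : F.Cl X) : Prop :=
  F.le M A ∧ F.le M B ∧ ∀ D : F.Cl X, F.le D A → F.le D B → F.le D M

/-- `T` is the direct image of `S` along `f`. -/
def IsDimgOf (F : Form C) {X Y : C} (f : X ⟶ Y) (S : F.Cl X) (T : F.Cl Y) : Prop :=
  F.Rel f S T ∧ ∀ T' : F.Cl Y, F.Rel f S T' → F.le T T'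

/-- `S` is the inverse image of `T` along `f`. -/
def IsIimgOf (F : Form C) {X Y : C} (f : X ⟶ Y) (T : F.Cl Y) (S : F.Cl X) : Prop :=
  F.Rel f S T ∧ ∀ S' : F.Cl X, F.Rel f S' T → F.le S' S

/-- Orean form: (O1) fibres are bounded lattices, (O3) direct and inverse images exist,
(O2) relations along composites decompose. -/
def IsOrean (F : Form C) : Prop :=
  (∀ X : C, ∃ b : F.Cl X, ∀ A, F.le b A) ∧
  (∀ X : C, ∃ t : F.Cl X, ∀ A, F.le A t) ∧
  (∀ (X : C) (A B : F.Cl X), ∃ J, F.IsJoinOf A B J) ∧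
  (∀ (X : C) (A B : F.Cl X), ∃ M, F.IsMeetOf A B M) ∧
  (∀ {X Y : C} (f : X ⟶ Y) (S : F.Cl X), ∃ T, F.IsDimgOf f S T) ∧
  (∀ {X Y : C} (f : X ⟶ Y) (T : F.Cl Y), ∃ S, F.IsIimgOf f T S) ∧
  (∀ {X Y Z : C} (f : X ⟶ Y) (g : Y ⟶ Z) (A : F.Cl X) (D : F.Cl Z),
      F.Rel (f ≫ g) A D → ∃ B : F.Cl Y, F.Rel f A B ∧ F.Rel g B D)

/-- `m` is an embedding of the (conormal) cluster `S`. -/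
def IsEmbeddingOf (F : Form C) {W X : C} (m : W ⟶ X) (S : F.Cl X) : Prop :=
  F.IsImageOf S m ∧ ∀ {W' : C} (f' : W' ⟶ X) (S' : F.Cl X),
    F.IsImageOf S' f' → F.le S' S → ∃! g : W' ⟶ W, g ≫ m = f'

/-- `e` is a quotient of the (normal) cluster `K`. -/
def IsQuotientOf (F : Form C) {X Y : C} (e : X ⟶ Y) (K : F.Cl X) : Prop :=
  F.IsKernelOf K e ∧ ∀ {Y' : C} (g' : X ⟶ Y') (K' : F.Cl X),
    F.IsKernelOf K' g' → F.le K K' → ∃! h : Y ⟶ Y', e ≫ h = g'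

/-- The axiom (N1) for a general form, stated via characterizing predicates. -/
def N1 (F : Form C) : Prop :=
  (∀ {X Y : C} (f : X ⟶ Y) (S V : F.Cl X) (T : F.Cl Y) (K J : F.Cl X),
      F.IsDimgOf f S T → F.IsIimgOf f T V → F.IsKernelOf K f → F.IsJoinOf S K J → V = J) ∧
  (∀ {X Y : C} (f : X ⟶ Y) (T : F.Cl Y) (S : F.Cl X) (U I M : F.Cl Y),
      F.IsIimgOf f T S → F.IsDimgOf f S U → F.IsImageOf I f → F.IsMeetOf T I M → U = M)

/-- The axiom (N2) for a general form. -/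
def N2 (F : Form C) : Prop :=
  ∀ {X Y : C} (f : X ⟶ Y), ∃ (I : C) (e : X ⟶ I) (m : I ⟶ Y) (K : F.Cl X) (S : F.Cl Y),
    F.IsKernelOf K f ∧ F.IsQuotientOf e K ∧ F.IsImageOf S f ∧ F.IsEmbeddingOf m S ∧ e ≫ m = f

/-- The axiom (N3) for a general form. -/
def N3 (F : Form C) : Prop :=
  (∀ {X : C} (S T J : F.Cl X), F.NormalCl S → F.NormalCl T → F.IsJoinOf S T J → F.NormalCl J) ∧
  (∀ {X : C} (S T M : F.Cl X), F.ConormalCl S → F.ConormalCl T → F.IsMeetOf S T M → F.ConormalCl M)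

/-- The subform of `F` given by a selection of clusters. -/
def Subform (F : Form C) (P : ∀ X : C, F.Cl X → Prop) : Form C where
  Cl X := {A : F.Cl X // P X A}
  Rel f A B := F.Rel f A.1 B.1
  rel_id A := F.rel_id A.1
  rel_comp h h' := F.rel_comp h h'
  rel_antisymm h h' := Subtype.ext (F.rel_antisymm h h')

/-- The product of two forms over the same category. -/
def prod (F G : Form C) : Form C where
  Cl X := F.Cl X × G.Cl X
  Rel f A B := F.Rel f A.1 B.1 ∧ G.Rel f A.2 B.2
  rel_id A := ⟨F.rel_id A.1, G.rel_id A.2⟩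
  rel_comp h h' := ⟨F.rel_comp h.1 h'.1, G.rel_comp h.2 h'.2⟩
  rel_antisymm h h' := Prod.ext (F.rel_antisymm h.1 h'.1) (G.rel_antisymm h.2 h'.2)

/-- Isomorphism of forms over the same category. -/
def IsIsomorphic (F G : Form C) : Prop :=
  ∃ e : ∀ X : C, F.Cl X ≃ G.Cl X,
    ∀ {X Y : C} (f : X ⟶ Y) (A : F.Cl X) (B : F.Cl Y),
      F.Rel f A B ↔ G.Rel f (e X A) (e Y B)

/-- An orean factorization (stated for general forms): a conormal orean form together
with a normal orean form such that every morphism factors as a quotient of its kernel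
followed by an embedding of its image. -/
def IsOreanFactorization (Fs Fe : Form C) : Prop :=
  Fs.IsOrean ∧ Fs.IsConormal ∧ Fe.IsOrean ∧ Fe.IsNormal ∧
  ∀ {X Y : C} (f : X ⟶ Y), ∃ (I : C) (e : X ⟶ I) (m : I ⟶ Y) (K : Fe.Cl X) (S : Fs.Cl Y),
    Fe.IsKernelOf K f ∧ Fe.IsQuotientOf e K ∧ Fs.IsImageOf S f ∧ Fs.IsEmbeddingOf m S ∧
    e ≫ m = f

end Form

/-- An operator between two forms over the same category. -/
structure Operator {C : Type u} [Category.{v} C] (F G : Form C) where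
  app : ∀ {X : C}, F.Cl X → G.Cl X
  mono : ∀ {X Y : C} {f : X ⟶ Y} {A : F.Cl X} {B : F.Cl Y},
      F.Rel f A B → G.Rel f (app A) (app B)

namespace Operator

variable {C : Type u} [Category.{v} C] {F G : Form C}

/-- A full operator. -/
def Full (τ : Operator F G) : Prop :=
  ∀ {X Y : C} {f : X ⟶ Y} {A : F.Cl X} {B : F.Cl Y},
    G.Rel f (τ.app A) (τ.app B) → F.Rel f A B

/-- A conormal operator: it maps images of morphisms to images. -/
def Conormal (τ : Operator F G) : Prop :=
  ∀ {W X : C} (f : W ⟶ X) (S : F.Cl X), F.IsImageOf S f → G.IsImageOf (τ.app S) f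

/-- A normal operator: it maps kernels of morphisms to kernels. -/
def Normal (τ : Operator F G) : Prop :=
  ∀ {X Y : C} (g : X ⟶ Y) (S : F.Cl X), F.IsKernelOf S g → G.IsKernelOf (τ.app S) g

end Operator

/-- The identity operator. -/
def Form.idOp {C : Type u} [Category.{v} C] (F : Form C) : Operator F F :=
  ⟨fun A => A, fun h => h⟩

/-- The inclusion of a subform. -/
def Form.subformIncl {C : Type u} [Category.{v} C] (F : Form C) (P : ∀ X : C, F.Cl X → Prop) :
    Operator (F.Subform P) F where
  app A := A.1
  mono h := h

/-- The subform of clusters fixed by an operator `κ : F → F`. -/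
def Form.fixedSubform {C : Type u} [Category.{v} C] (F : Form C) (κ : Operator F F) : Form C :=
  F.Subform (fun _ A => κ.app A = A)

/-- A semiexact pair of forms. -/
def IsSemiexactPair {C : Type u} [Category.{v} C] (Fs Fe : Form C) : Prop :=
  Fs.IsOrean ∧ Fs.IsConormal ∧ Fe.IsOrean ∧ Fe.IsNormal ∧
  (∃ α : Operator Fs Fe, α.Conormal) ∧ (∃ β : Operator Fe Fs, β.Normal)

/-- A left exact pair of forms: a semiexact pair where the conormal operator is a
left inverse of the normal operator. -/
def IsLeftExactPair {C : Type u} [Category.{v} C] (Fs Fe : Form C) : Prop :=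
  Fs.IsOrean ∧ Fs.IsConormal ∧ Fe.IsOrean ∧ Fe.IsNormal ∧
  ∃ (α : Operator Fs Fe) (β : Operator Fe Fs), α.Conormal ∧ β.Normal ∧
    ∀ {X : C} (R : Fe.Cl X), α.app (β.app R) = R

/-- An orean form, with the (uniquely determined) bounded-lattice and
direct/inverse image structure bundled. -/
structure OreanForm (C : Type u) [Category.{v} C] extends Form C where
  bot : ∀ X : C, Cl X
  top : ∀ X : C, Cl X
  join : ∀ {X : C}, Cl X → Cl X → Cl X
  meet : ∀ {X : C}, Cl X → Cl X → Cl X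
  dimg : ∀ {X Y : C}, (X ⟶ Y) → Cl X → Cl Y
  iimg : ∀ {X Y : C}, (X ⟶ Y) → Cl Y → Cl X
  bot_le : ∀ {X : C} (A : Cl X), Rel (𝟙 X) (bot X) A
  le_top : ∀ {X : C} (A : Cl X), Rel (𝟙 X) A (top X)
  le_join_left : ∀ {X : C} (A B : Cl X), Rel (𝟙 X) A (join A B)
  le_join_right : ∀ {X : C} (A B : Cl X), Rel (𝟙 X) B (join A B)
  join_le : ∀ {X : C} {A B D : Cl X}, Rel (𝟙 X) A D → Rel (𝟙 X) B D → Rel (𝟙 X) (join A B) D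
  meet_le_left : ∀ {X : C} (A B : Cl X), Rel (𝟙 X) (meet A B) A
  meet_le_right : ∀ {X : C} (A B : Cl X), Rel (𝟙 X) (meet A B) B
  le_meet : ∀ {X : C} {A B D : Cl X}, Rel (𝟙 X) D A → Rel (𝟙 X) D B → Rel (𝟙 X) D (meet A B)
  rel_dimg : ∀ {X Y : C} (f : X ⟶ Y) (S : Cl X), Rel f S (dimg f S)
  dimg_le : ∀ {X Y : C} {f : X ⟶ Y} {S : Cl X} {T : Cl Y}, Rel f S T → Rel (𝟙 Y) (dimg f S) T
  iimg_rel : ∀ {X Y : C} (f : X ⟶ Y) (T : Cl Y), Rel f (iimg f T) T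
  le_iimg : ∀ {X Y : C} {f : X ⟶ Y} {S : Cl X} {T : Cl Y}, Rel f S T → Rel (𝟙 X) S (iimg f T)
  rel_decomp : ∀ {X Y Z : C} {f : X ⟶ Y} {g : Y ⟶ Z} {A : Cl X} {D : Cl Z},
      Rel (f ≫ g) A D → ∃ B : Cl Y, Rel f A B ∧ Rel g B D

namespace OreanForm

variable {C : Type u} [Category.{v} C]

def le (F : OreanForm C) {X : C} (A B : F.Cl X) : Prop := F.Rel (𝟙 X) A B

/-- The image of a morphism: direct image of the top cluster. -/
def Im (F : OreanForm C) {W X : C} (f : W ⟶ X) : F.Cl X := F.dimg f (F.top W)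

/-- The kernel of a morphism: inverse image of the bottom cluster. -/
def Ker (F : OreanForm C) {X Y : C} (g : X ⟶ Y) : F.Cl X := F.iimg g (F.bot Y)

def Conormal (F : OreanForm C) {X : C} (S : F.Cl X) : Prop :=
  ∃ (W : C) (f : W ⟶ X), F.Im f = S

def Normal (F : OreanForm C) {X : C} (S : F.Cl X) : Prop :=
  ∃ (Y : C) (g : X ⟶ Y), F.Ker g = S

def IsConormalForm (F : OreanForm C) : Prop := ∀ {X : C} (S : F.Cl X), F.Conormal S

def IsNormalForm (F : OreanForm C) : Prop := ∀ {X : C} (S : F.Cl X), F.Normal S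

def IsBinormalForm (F : OreanForm C) : Prop := F.IsConormalForm ∧ F.IsNormalForm

/-- `m` is an embedding of the cluster `S`. -/
def IsEmbedding (F : OreanForm C) {W X : C} (m : W ⟶ X) (S : F.Cl X) : Prop :=
  F.Im m = S ∧ ∀ {W' : C} (f' : W' ⟶ X), F.le (F.Im f') S → ∃! g : W' ⟶ W, g ≫ m = f'

/-- `e` is a quotient of the cluster `K`. -/
def IsQuotient (F : OreanForm C) {X Y : C} (e : X ⟶ Y) (K : F.Cl X) : Prop :=
  F.Ker e = K ∧ ∀ {Y' : C} (g' : X ⟶ Y'), F.le K (F.Ker g') → ∃! h : Y ⟶ Y', e ≫ h = g'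

/-- The axiom (N1) at a given morphism. -/
def N1At (F : OreanForm C) {X Y : C} (f : X ⟶ Y) : Prop :=
  (∀ S : F.Cl X, F.iimg f (F.dimg f S) = F.join S (F.Ker f)) ∧
  (∀ T : F.Cl Y, F.dimg f (F.iimg f T) = F.meet T (F.Im f))

def N1 (F : OreanForm C) : Prop := ∀ {X Y : C} (f : X ⟶ Y), F.N1At f

def N2 (F : OreanForm C) : Prop :=
  ∀ {X Y : C} (f : X ⟶ Y), ∃ (I : C) (e : X ⟶ I) (m : I ⟶ Y),
    F.IsQuotient e (F.Ker f) ∧ F.IsEmbedding m (F.Im f) ∧ e ≫ m = f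

def N3 (F : OreanForm C) : Prop :=
  (∀ {X : C} (S T : F.Cl X), F.Normal S → F.Normal T → F.Normal (F.join S T)) ∧
  (∀ {X : C} (S T : F.Cl X), F.Conormal S → F.Conormal T → F.Conormal (F.meet S T))

def IsNoetherian (F : OreanForm C) : Prop := F.N1 ∧ F.N2 ∧ F.N3

/-- The conormal hull: the subform of conormal clusters. -/
def conormalHull (F : OreanForm C) : Form C := F.toForm.Subform (fun _ S => F.Conormal S)

/-- The normal hull: the subform of normal clusters. -/
def normalHull (F : OreanForm C) : Form C := F.toForm.Subform (fun _ S => F.Normal S)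

def conormalIncl (F : OreanForm C) : Operator F.conormalHull F.toForm :=
  F.toForm.subformIncl _

def normalIncl (F : OreanForm C) : Operator F.normalHull F.toForm :=
  F.toForm.subformIncl _

/-- A strongly orean form: the conormal and normal hulls are both orean. -/
def StronglyOrean (F : OreanForm C) : Prop :=
  F.conormalHull.IsOrean ∧ F.normalHull.IsOrean

/-- `T` is the conormal interior of `S` (largest conormal cluster below `S`). -/
def IsConormalInterior (F : OreanForm C) {X : C} (S T : F.Cl X) : Prop :=
  F.Conormal T ∧ F.le T S ∧ ∀ T' : F.Cl X, F.Conormal T' → F.le T' S → F.le T' T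

/-- `T` is the conormal exterior of `S` (smallest conormal cluster above `S`). -/
def IsConormalExterior (F : OreanForm C) {X : C} (S T : F.Cl X) : Prop :=
  F.Conormal T ∧ F.le S T ∧ ∀ T' : F.Cl X, F.Conormal T' → F.le S T' → F.le T T'

/-- `T` is the normal interior of `S` (largest normal cluster below `S`). -/
def IsNormalInterior (F : OreanForm C) {X : C} (S T : F.Cl X) : Prop :=
  F.Normal T ∧ F.le T S ∧ ∀ T' : F.Cl X, F.Normal T' → F.le T' S → F.le T' T

/-- `T` is the normal exterior of `S` (smallest normal cluster above `S`). -/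
def IsNormalExterior (F : OreanForm C) {X : C} (S T : F.Cl X) : Prop :=
  F.Normal T ∧ F.le S T ∧ ∀ T' : F.Cl X, F.Normal T' → F.le S T' → F.le T T'

/-- Componentwise product of orean forms. -/
def prod (F G : OreanForm C) : OreanForm C where
  toForm := F.toForm.prod G.toForm
  bot X := (F.bot X, G.bot X)
  top X := (F.top X, G.top X)
  join A B := (F.join A.1 B.1, G.join A.2 B.2)
  meet A B := (F.meet A.1 B.1, G.meet A.2 B.2)
  dimg f S := (F.dimg f S.1, G.dimg f S.2)
  iimg f T := (F.iimg f T.1, G.iimg f T.2)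
  bot_le A := ⟨F.bot_le A.1, G.bot_le A.2⟩
  le_top A := ⟨F.le_top A.1, G.le_top A.2⟩
  le_join_left A B := ⟨F.le_join_left A.1 B.1, G.le_join_left A.2 B.2⟩
  le_join_right A B := ⟨F.le_join_right A.1 B.1, G.le_join_right A.2 B.2⟩
  join_le h h' := ⟨F.join_le h.1 h'.1, G.join_le h.2 h'.2⟩
  meet_le_left A B := ⟨F.meet_le_left A.1 B.1, G.meet_le_left A.2 B.2⟩
  meet_le_right A B := ⟨F.meet_le_right A.1 B.1, G.meet_le_right A.2 B.2⟩
  le_meet h h' := ⟨F.le_meet h.1 h'.1, G.le_meet h.2 h'.2⟩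
  rel_dimg f S := ⟨F.rel_dimg f S.1, G.rel_dimg f S.2⟩
  dimg_le h := ⟨F.dimg_le h.1, G.dimg_le h.2⟩
  iimg_rel f T := ⟨F.iimg_rel f T.1, G.iimg_rel f T.2⟩
  le_iimg h := ⟨F.le_iimg h.1, G.le_iimg h.2⟩
  rel_decomp h := by
    obtain ⟨B1, h1, h1'⟩ := F.rel_decomp h.1
    obtain ⟨B2, h2, h2'⟩ := G.rel_decomp h.2
    exact ⟨(B1, B2), ⟨h1, h2⟩, ⟨h1', h2'⟩⟩

end OreanForm

/-- An orean factorization, stated for orean forms. -/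
def OreanFactorization {C : Type u} [Category.{v} C] (Fs Fe : OreanForm C) : Prop :=
  Fs.IsConormalForm ∧ Fe.IsNormalForm ∧
  ∀ {X Y : C} (f : X ⟶ Y), ∃ (I : C) (e : X ⟶ I) (m : I ⟶ Y),
    Fe.IsQuotient e (Fe.Ker f) ∧ Fs.IsEmbedding m (Fs.Im f) ∧ e ≫ m = f

/-- A conormal operator between orean forms (preserves images). -/
def OpConormal {C : Type u} [Category.{v} C] {Fs Fe : OreanForm C}
    (α : Operator Fs.toForm Fe.toForm) : Prop :=
  ∀ {W X : C} (f : W ⟶ X), α.app (Fs.Im f) = Fe.Im f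

/-- A normal operator between orean forms (preserves kernels). -/
def OpNormal {C : Type u} [Category.{v} C] {Fs Fe : OreanForm C}
    (β : Operator Fs.toForm Fe.toForm) : Prop :=
  ∀ {X Y : C} (g : X ⟶ Y), β.app (Fs.Ker g) = Fe.Ker g

/-- `W` is the Wyler join `A ∗ R = (π_R ·ˢ A) ·ˢ π_R` relative to an orean
factorization `(Fs, Fe)`. -/
def WylerJoin {C : Type u} [Category.{v} C] (Fs Fe : OreanForm C) {X : C}
    (A : Fs.Cl X) (R : Fe.Cl X) (W : Fs.Cl X) : Prop :=
  ∃ (Q : C) (p : X ⟶ Q), Fe.IsQuotient p R ∧ Fs.iimg p (Fs.dimg p A) = W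

section Decomp

variable {C : Type u} [Category.{v} C]

/-- Core of a decomposition: a pair of idempotent operators whose subforms of fixed
clusters are a conormal orean form resp. a normal orean form. -/
def IsDecompCore (F : OreanForm C) (κs κe : Operator F.toForm F.toForm) : Prop :=
  (∀ {X : C} (A : F.Cl X), κs.app (κs.app A) = κs.app A) ∧
  (∀ {X : C} (A : F.Cl X), κe.app (κe.app A) = κe.app A) ∧
  (F.toForm.fixedSubform κs).IsOrean ∧ (F.toForm.fixedSubform κs).IsConormal ∧
  (F.toForm.fixedSubform κe).IsOrean ∧ (F.toForm.fixedSubform κe).IsNormal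

def JoinEq (F : OreanForm C) (κs κe : Operator F.toForm F.toForm) : Prop :=
  ∀ {X : C} (S : F.Cl X), S = F.join (κs.app S) (κe.app S)

def MeetEq (F : OreanForm C) (κs κe : Operator F.toForm F.toForm) : Prop :=
  ∀ {X : C} (S : F.Cl X), S = F.meet (κs.app S) (κe.app S)

def LeftEq (F : OreanForm C) (κs : Operator F.toForm F.toForm) : Prop :=
  ∀ {X : C} (S : F.Cl X), S = κs.app S

def RightEq (F : OreanForm C) (κe : Operator F.toForm F.toForm) : Prop :=
  ∀ {X : C} (S : F.Cl X), S = κe.app S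

def TopEq (F : OreanForm C) : Prop := ∀ {X : C} (S : F.Cl X), S = F.top X

def BotEq (F : OreanForm C) : Prop := ∀ {X : C} (S : F.Cl X), S = F.bot X

/-- A decomposition of an orean form: the decomposing term is one of the six
binary bounded-lattice terms. -/
def IsDecomp (F : OreanForm C) (κs κe : Operator F.toForm F.toForm) : Prop :=
  IsDecompCore F κs κe ∧
  (JoinEq F κs κe ∨ MeetEq F κs κe ∨ LeftEq F κs ∨ RightEq F κe ∨ TopEq F ∨ BotEq F)

def IsJoinDecomp (F : OreanForm C) (κs κe : Operator F.toForm F.toForm) : Prop :=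
  IsDecompCore F κs κe ∧ JoinEq F κs κe

def IsMeetDecomp (F : OreanForm C) (κs κe : Operator F.toForm F.toForm) : Prop :=
  IsDecompCore F κs κe ∧ MeetEq F κs κe

def IsLeftDecomp (F : OreanForm C) (κs κe : Operator F.toForm F.toForm) : Prop :=
  IsDecompCore F κs κe ∧ LeftEq F κs

def IsRightDecomp (F : OreanForm C) (κs κe : Operator F.toForm F.toForm) : Prop :=
  IsDecompCore F κs κe ∧ RightEq F κe

/-- A semiexact decomposition: the decomposition projections are binormal and the pair
of fixed subforms is a semiexact pair. -/
def IsSemiexact (F : OreanForm C) (κs κe : Operator F.toForm F.toForm) : Prop :=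
  (∃ τs : Operator F.toForm (F.toForm.fixedSubform κs),
      (∀ {X : C} (A : F.Cl X), (τs.app A).1 = κs.app A) ∧ τs.Conormal ∧ τs.Normal) ∧
  (∃ τe : Operator F.toForm (F.toForm.fixedSubform κe),
      (∀ {X : C} (A : F.Cl X), (τe.app A).1 = κe.app A) ∧ τe.Conormal ∧ τe.Normal) ∧
  IsSemiexactPair (F.toForm.fixedSubform κs) (F.toForm.fixedSubform κe)

/-- An exact decomposition: semiexact, and the subform inclusions are
conormal resp. normal. -/
def IsExact (F : OreanForm C) (κs κe : Operator F.toForm F.toForm) : Prop :=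
  IsSemiexact F κs κe ∧
  (F.toForm.subformIncl (fun _ A => κs.app A = A)).Conormal ∧
  (F.toForm.subformIncl (fun _ A => κe.app A = A)).Normal

end Decomp

namespace EJD

universe w₁ w₂

variable {C : Type u} [Category.{v} C]

section Basic

variable (F : OreanForm.{v, u, w₁} C)

lemma le_trans_rel {X Y : C} {f : X ⟶ Y} {A B : F.Cl X} {D : F.Cl Y}
    (h : F.Rel (𝟙 X) A B) (h' : F.Rel f B D) : F.Rel f A D := by
  simpa using F.rel_comp h h'

lemma rel_trans_le {X Y : C} {f : X ⟶ Y} {A : F.Cl X} {B D : F.Cl Y}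
    (h : F.Rel f A B) (h' : F.Rel (𝟙 Y) B D) : F.Rel f A D := by
  simpa using F.rel_comp h h'

lemma comp_dimg {X Y Z : C} (f : X ⟶ Y) (g : Y ⟶ Z) (A : F.Cl X) (D : F.Cl Z) :
    F.Rel (f ≫ g) A D ↔ F.Rel g (F.dimg f A) D := by
  constructor
  · intro h
    obtain ⟨B, h1, h2⟩ := F.rel_decomp h
    exact le_trans_rel F (F.dimg_le h1) h2
  · intro h
    exact F.rel_comp (F.rel_dimg f A) h

lemma comp_iimg {X Y Z : C} (f : X ⟶ Y) (g : Y ⟶ Z) (A : F.Cl X) (D : F.Cl Z) :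
    F.Rel (f ≫ g) A D ↔ F.Rel f A (F.iimg g D) := by
  constructor
  · intro h
    obtain ⟨B, h1, h2⟩ := F.rel_decomp h
    exact rel_trans_le F h1 (F.le_iimg h2)
  · intro h
    exact F.rel_comp h (F.iimg_rel g D)

lemma dimg_iff {X Y : C} (f : X ⟶ Y) (A : F.Cl X) (D : F.Cl Y) :
    F.Rel (𝟙 Y) (F.dimg f A) D ↔ F.Rel f A D := by
  rw [← comp_dimg]; simp

lemma iimg_iff {X Y : C} (f : X ⟶ Y) (A : F.Cl X) (D : F.Cl Y) :
    F.Rel (𝟙 X) A (F.iimg f D) ↔ F.Rel f A D := by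
  rw [← comp_iimg]; simp

lemma rel_Im {W X Y : C} (a : W ⟶ X) (h : X ⟶ Y) (T : F.Cl Y) :
    F.Rel h (F.Im a) T ↔ F.Rel (𝟙 Y) (F.Im (a ≫ h)) T := by
  unfold OreanForm.Im
  rw [← comp_dimg, dimg_iff]

lemma rel_Ker {X Y Z : C} (h : X ⟶ Y) (b : Y ⟶ Z) (S : F.Cl X) :
    F.Rel h S (F.Ker b) ↔ F.Rel (𝟙 X) S (F.Ker (h ≫ b)) := by
  unfold OreanForm.Ker
  rw [← comp_iimg, iimg_iff]

lemma dimg_Im {W X Y : C} (a : W ⟶ X) (h : X ⟶ Y) :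
    F.dimg h (F.Im a) = F.Im (a ≫ h) := by
  apply F.rel_antisymm
  · rw [dimg_iff, rel_Im]; exact F.rel_id _
  · rw [← rel_Im]; exact F.rel_dimg _ _

lemma Im_comp_le {W X Y : C} (a : W ⟶ X) (h : X ⟶ Y) :
    F.Rel (𝟙 Y) (F.Im (a ≫ h)) (F.Im h) := by
  rw [← rel_Im]
  exact le_trans_rel F (F.le_top _) (F.rel_dimg _ _)

lemma Ker_le_comp {X Y Z : C} (h : X ⟶ Y) (b : Y ⟶ Z) :
    F.Rel (𝟙 X) (F.Ker h) (F.Ker (h ≫ b)) := by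
  rw [← rel_Ker]
  exact rel_trans_le F (F.iimg_rel _ _) (F.bot_le _)

lemma rel_join_left {X Y : C} (f : X ⟶ Y) (A B : F.Cl X) (T : F.Cl Y) :
    F.Rel f (F.join A B) T ↔ F.Rel f A T ∧ F.Rel f B T := by
  constructor
  · intro h
    exact ⟨le_trans_rel F (F.le_join_left _ _) h, le_trans_rel F (F.le_join_right _ _) h⟩
  · rintro ⟨h1, h2⟩
    rw [← iimg_iff] at *
    exact F.join_le h1 h2

/-- Quotients have full image. -/
lemma quot_top (hF : F.IsNoetherian) {X Y : C} {e : X ⟶ Y} {R : F.Cl X}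
    (he : F.IsQuotient e R) (T : F.Cl Y) : F.Rel (𝟙 Y) T (F.Im e) := by
  obtain ⟨hR, hu⟩ := he
  obtain ⟨I, e', m', he', hm', hc⟩ := hF.2.1 e
  have hk : F.le R (F.Ker e') := by
    rw [he'.1, hR]; exact F.rel_id _
  obtain ⟨p, hp, -⟩ := hu e' hk
  have h1 : p ≫ m' = 𝟙 Y := by
    have hself : F.le R (F.Ker e) := by rw [hR]; exact F.rel_id _
    refine (hu e hself).unique ?_ (by simp)
    rw [← Category.assoc, hp, hc]
  rw [← hm'.1]
  have := F.rel_comp (rel_trans_le F (F.rel_dimg p T) (F.le_top _)) (F.rel_dimg m' (F.top I))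
  rw [h1] at this
  exact this

/-- Embeddings have trivial kernel. -/
lemma emb_bot (hF : F.IsNoetherian) {X Y : C} {m : X ⟶ Y} {R : F.Cl Y}
    (he : F.IsEmbedding m R) (T : F.Cl X) : F.Rel (𝟙 X) (F.Ker m) T := by
  obtain ⟨hR, hu⟩ := he
  obtain ⟨I, e', m', he', hm', hc⟩ := hF.2.1 m
  have hk : F.le (F.Im m') R := by
    rw [hm'.1, hR]; exact F.rel_id _
  obtain ⟨p, hp, -⟩ := hu m' hk
  have h1 : e' ≫ p = 𝟙 X := by
    have hself : F.le (F.Im m) R := by rw [hR]; exact F.rel_id _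
    refine (hu m hself).unique ?_ (by simp)
    rw [Category.assoc, hp, hc]
  rw [← he'.1]
  have := F.rel_comp (F.iimg_rel e' (F.bot I)) (le_trans_rel F (F.bot_le _) (F.iimg_rel p T))
  rw [h1] at this
  exact this

lemma rel_join_right (hF : F.IsNoetherian) {W X Y Z : C} (h : W ⟶ X) (b : Y ⟶ X) (q : X ⟶ Z)
    (S : F.Cl W) :
    F.Rel h S (F.join (F.Im b) (F.Ker q)) ↔ F.Rel (h ≫ q) S (F.Im (b ≫ q)) := by
  rw [← (hF.1 q).1, dimg_Im, comp_iimg]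

lemma Im_of_isImageOf {W X : C} {S : F.Cl X} {f : W ⟶ X} (h : F.toForm.IsImageOf S f) :
    F.Im f = S := by
  obtain ⟨t, ht, h1, h2⟩ := h
  have : t = F.top W := F.rel_antisymm (F.le_top t) (ht _)
  subst this
  exact F.rel_antisymm (F.dimg_le h1) (h2 _ (F.rel_dimg _ _))

lemma Ker_of_isKernelOf {X Y : C} {S : F.Cl X} {f : X ⟶ Y} (h : F.toForm.IsKernelOf S f) :
    F.Ker f = S := by
  obtain ⟨t, ht, h1, h2⟩ := h
  have : t = F.bot Y := F.rel_antisymm (ht _) (F.bot_le t)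
  subst this
  exact F.rel_antisymm (h2 _ (F.iimg_rel _ _)) (F.le_iimg h1)

lemma isKernelOf_Ker {X Y : C} (f : X ⟶ Y) : F.toForm.IsKernelOf (F.Ker f) f :=
  ⟨F.bot Y, fun A => F.bot_le A, F.iimg_rel _ _, fun _ h => F.le_iimg h⟩

end Basic

section Transfer

variable (G : OreanForm.{v, u, w₁} C) (F : OreanForm.{v, u, w₂} C)

lemma Im_transfer (hG : G.IsNoetherian) (hF : F.IsNoetherian)
    (hquot : ∀ {X Y : C} (e : X ⟶ Y),
      (∃ R : G.Cl X, G.IsQuotient e R) → (∃ R : F.Cl X, F.IsQuotient e R))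
    {W W' X : C} (f : W ⟶ X) (f' : W' ⟶ X) (h : G.Rel (𝟙 X) (G.Im f) (G.Im f')) :
    F.Rel (𝟙 X) (F.Im f) (F.Im f') := by
  obtain ⟨I, e, m, he, hm, hc⟩ := hG.2.1 f'
  obtain ⟨g, hg, -⟩ := hm.2 f h
  obtain ⟨R, hR⟩ := hquot e ⟨_, he⟩
  have h1 : F.Rel (𝟙 X) (F.Im m) (F.Im f') := by
    rw [← hc, ← dimg_Im, OreanForm.Im, dimg_iff]
    exact le_trans_rel F (quot_top F hF hR _) (F.rel_dimg _ _)
  have h2 := Im_comp_le F g m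
  rw [hg] at h2
  exact le_trans_rel F h2 h1

lemma Ker_transfer (hG : G.IsNoetherian) (hF : F.IsNoetherian)
    (hemb : ∀ {W X : C} (m : W ⟶ X),
      (∃ S : G.Cl X, G.IsEmbedding m S) → (∃ S : F.Cl X, F.IsEmbedding m S))
    {Y Y' X : C} (f : X ⟶ Y) (f' : X ⟶ Y') (h : G.Rel (𝟙 X) (G.Ker f) (G.Ker f')) :
    F.Rel (𝟙 X) (F.Ker f) (F.Ker f') := by
  obtain ⟨I, e, m, he, hm, hc⟩ := hG.2.1 f
  obtain ⟨g, hg, -⟩ := he.2 f' h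
  obtain ⟨R, hR⟩ := hemb m ⟨_, hm⟩
  have h1 : F.Rel (𝟙 X) (F.Ker f) (F.Ker e) := by
    rw [← hc]
    refine (iimg_iff F e _ _).2 ?_
    have : F.Rel e (F.Ker (e ≫ m)) (F.Ker m) := by
      rw [rel_Ker]; exact F.rel_id _
    exact rel_trans_le F this (emb_bot F hF hR _)
  have h2 := Ker_le_comp F e g
  rw [hg] at h2
  exact le_trans_rel F h1 h2

end Transfer

section Key

variable (G : OreanForm.{v, u, w₁} C) (F : OreanForm.{v, u, w₂} C)

/-- Kernel below image, transferred from `F` to `G`. -/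
lemma KerIm_transfer (hF : F.IsNoetherian)
    (kGF : ∀ {X Y Y' : C} (f : X ⟶ Y) (f' : X ⟶ Y'),
      G.Rel (𝟙 X) (G.Ker f) (G.Ker f') ↔ F.Rel (𝟙 X) (F.Ker f) (F.Ker f'))
    (κe : Operator G.toForm G.toForm)
    (hle : ∀ {X : C} (A : G.Cl X), G.Rel (𝟙 X) (κe.app A) A)
    (hnor : ∀ {X : C} (A : G.Cl X), G.Normal (κe.app A))
    (hfix : ∀ {X Y : C} (f : X ⟶ Y), κe.app (G.Ker f) = G.Ker f)
    {W X Y : C} (a : X ⟶ Y) (c : W ⟶ X) (h : F.Rel (𝟙 X) (F.Ker a) (F.Im c)) :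
    G.Rel (𝟙 X) (G.Ker a) (G.Im c) := by
  obtain ⟨B, b, hb⟩ := hnor (G.Im c)
  obtain ⟨B', t, ht⟩ := hnor (G.top W)
  have h1 : G.Rel c (G.Ker t) (G.Ker b) := by
    rw [hb, ht]; exact κe.mono (G.rel_dimg _ _)
  rw [rel_Ker, kGF, ← rel_Ker] at h1
  have h2 : F.Rel (𝟙 W) (F.Ker (c ≫ a)) (F.Ker t) := by
    rw [← kGF, ht, ← hfix (c ≫ a)]
    exact κe.mono (G.le_top _)
  have h3 : F.Rel (𝟙 X) (F.Ker a) (F.Ker b) := by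
    have h4 : F.Rel (𝟙 X) (F.dimg c (F.iimg c (F.Ker a))) (F.Ker b) := by
      rw [dimg_iff]
      refine le_trans_rel F (le_trans_rel F ?_ h2) h1
      rw [← rel_Ker]; exact F.iimg_rel _ _
    rw [(hF.1 c).2] at h4
    exact le_trans_rel F (F.le_meet (F.rel_id _) h) h4
  rw [← kGF, hb] at h3
  exact le_trans_rel G h3 (hle _)

/-- The relative version. -/
lemma KerIm_rel_transfer (hF : F.IsNoetherian)
    (kGF : ∀ {X Y Y' : C} (f : X ⟶ Y) (f' : X ⟶ Y'),
      G.Rel (𝟙 X) (G.Ker f) (G.Ker f') ↔ F.Rel (𝟙 X) (F.Ker f) (F.Ker f'))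
    (iGF : ∀ {X Y Y' : C} (f : Y ⟶ X) (f' : Y' ⟶ X),
      G.Rel (𝟙 X) (G.Im f) (G.Im f') ↔ F.Rel (𝟙 X) (F.Im f) (F.Im f'))
    (κe : Operator G.toForm G.toForm)
    (hle : ∀ {X : C} (A : G.Cl X), G.Rel (𝟙 X) (κe.app A) A)
    (hnor : ∀ {X : C} (A : G.Cl X), G.Normal (κe.app A))
    (hfix : ∀ {X Y : C} (f : X ⟶ Y), κe.app (G.Ker f) = G.Ker f)
    {V W X Y : C} (a : X ⟶ Y) (h : X ⟶ V) (c : W ⟶ V) (H : F.Rel h (F.Ker a) (F.Im c)) :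
    G.Rel h (G.Ker a) (G.Im c) := by
  obtain ⟨I, e, m, he, hm, hc⟩ := hF.2.1 h
  have hek : F.Rel (𝟙 X) (F.Ker e) (F.Ker h) := by rw [he.1]; exact F.rel_id _
  -- enlarge the kernel
  obtain ⟨Y', a0, ha0⟩ := hF.2.2.1 (F.Ker a) (F.Ker e) ⟨_, _, rfl⟩ ⟨_, _, rfl⟩
  have hea : F.le (F.Ker h) (F.Ker a0) := by
    rw [ha0, ← he.1]; exact F.le_join_right _ _
  obtain ⟨a', ha', -⟩ := he.2 a0 hea
  have hG1 : G.Rel (𝟙 X) (G.Ker a) (G.Ker a0) := by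
    rw [kGF, ha0]; exact F.le_join_left _ _
  have H0 : F.Rel h (F.Ker a0) (F.Im c) := by
    rw [ha0, rel_join_left]
    refine ⟨H, ?_⟩
    refine le_trans_rel F hek ?_
    exact rel_trans_le F (F.iimg_rel _ _) (F.bot_le _)
  -- pass to the image
  have H1 : F.Rel m (F.Ker a') (F.Im c) := by
    rw [← hc, comp_dimg, ← ha'] at H0
    refine le_trans_rel F ?_ H0
    have h5 : F.Rel (𝟙 I) (F.Ker a') (F.dimg e (F.iimg e (F.Ker a'))) := by
      rw [(hF.1 e).2]
      exact F.le_meet (F.rel_id _) (quot_top F hF he _)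
    refine le_trans_rel F h5 ?_
    rw [dimg_iff]
    refine le_trans_rel F ?_ (F.rel_dimg _ _)
    rw [← rel_Ker]; exact F.iimg_rel _ _
  -- intersect
  obtain ⟨D, d, hd⟩ := hF.2.2.2 (F.Im c) (F.Im m) ⟨_, _, rfl⟩ ⟨_, _, rfl⟩
  have hdm : F.le (F.Im d) (F.Im h) := by
    rw [hd, ← hm.1]; exact F.meet_le_right _ _
  obtain ⟨d', hd', -⟩ := hm.2 d hdm
  have H2 : F.Rel (𝟙 I) (F.Ker a') (F.Im d') := by
    have h6 : F.Rel m (F.Ker a') (F.Im d) := by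
      rw [← dimg_iff, hd]
      refine F.le_meet ((dimg_iff F _ _ _).2 H1) ((dimg_iff F _ _ _).2 ?_)
      exact le_trans_rel F (F.le_top _) (F.rel_dimg _ _)
    rw [← hd', ← dimg_Im, ← iimg_iff, (hF.1 m).1] at h6
    exact le_trans_rel F h6 (F.join_le (F.rel_id _) (emb_bot F hF hm _))
  have H3 := KerIm_transfer G F hF kGF κe hle hnor hfix a' d' H2
  have H4 : G.Rel m (G.Im d') (G.Im c) := by
    rw [rel_Im, iGF, hd', hd]; exact F.meet_le_left _ _
  refine le_trans_rel G hG1 ?_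
  rw [← hc]
  refine G.rel_comp (B := G.Ker a') ?_ (le_trans_rel G H3 H4)
  rw [rel_Ker, ha']; exact G.rel_id _

end Key

end EJD

/-- Theorem (optimality): let `F`, `G` be noetherian forms over the same category with
the same embeddings and the same quotients. If `G` has an exact join decomposition,
then `G` is isomorphic to a subform of `F`. -/
theorem exact_join_decomposition_optimal {C : Type u} [Category.{v} C]
    (F G : OreanForm C) (hF : F.IsNoetherian) (hG : G.IsNoetherian)
    (hemb : ∀ {W X : C} (m : W ⟶ X),
      (∃ S : G.Cl X, G.IsEmbedding m S) ↔ (∃ S : F.Cl X, F.IsEmbedding m S))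
    (hquot : ∀ {X Y : C} (e : X ⟶ Y),
      (∃ R : G.Cl X, G.IsQuotient e R) ↔ (∃ R : F.Cl X, F.IsQuotient e R))
    (hGd : ∃ κs κe : Operator G.toForm G.toForm, IsJoinDecomp G κs κe ∧ IsExact G κs κe) :
    ∃ P : ∀ X : C, F.Cl X → Prop, Form.IsIsomorphic G.toForm (F.toForm.Subform P) := by
  obtain ⟨κs, κe, ⟨⟨hs1, he1, -, hsc, -, hen⟩, hj⟩, ⟨⟨-, ⟨τe, hτe, -, hτen⟩, -⟩, hinc, hinn⟩⟩ := hGd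
  have kGF : ∀ {X Y Y' : C} (f : X ⟶ Y) (f' : X ⟶ Y'),
      G.Rel (𝟙 X) (G.Ker f) (G.Ker f') ↔ F.Rel (𝟙 X) (F.Ker f) (F.Ker f') := fun f f' =>
    ⟨EJD.Ker_transfer G F hG hF (fun m => (hemb m).1) f f',
      EJD.Ker_transfer F G hF hG (fun m => (hemb m).2) f f'⟩
  have iGF : ∀ {X Y Y' : C} (f : Y ⟶ X) (f' : Y' ⟶ X),
      G.Rel (𝟙 X) (G.Im f) (G.Im f') ↔ F.Rel (𝟙 X) (F.Im f) (F.Im f') := fun f f' =>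
    ⟨EJD.Im_transfer G F hG hF (fun m => (hquot m).1) f f',
      EJD.Im_transfer F G hF hG (fun m => (hquot m).2) f f'⟩
  have hle : ∀ {X : C} (A : G.Cl X), G.Rel (𝟙 X) (κe.app A) A := by
    intro X A
    have h := G.le_join_right (κs.app A) (κe.app A)
    rwa [← hj A] at h
  have hcon : ∀ {X : C} (A : G.Cl X), G.Conormal (κs.app A) := by
    intro X A
    obtain ⟨W, f, hf⟩ := hsc X ⟨κs.app A, hs1 A⟩
    exact ⟨W, f, EJD.Im_of_isImageOf G (hinc f _ hf)⟩
  have hnor : ∀ {X : C} (A : G.Cl X), G.Normal (κe.app A) := by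
    intro X A
    obtain ⟨W, f, hf⟩ := hen X ⟨κe.app A, he1 A⟩
    exact ⟨W, f, EJD.Ker_of_isKernelOf G (hinn f _ hf)⟩
  have hfix : ∀ {X Y : C} (f : X ⟶ Y), κe.app (G.Ker f) = G.Ker f := by
    intro X Y f
    have h := EJD.Ker_of_isKernelOf G (hinn f _ (hτen f _ (EJD.isKernelOf_Ker G f)))
    exact (hτe _).symm.trans h.symm
  choose Wa a ha using @hcon
  choose Wq q hq using @hnor
  let τ : ∀ X : C, G.Cl X → F.Cl X := fun X A => F.join (F.Im (a A)) (F.Ker (q A))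
  have hGj : ∀ {X : C} (A : G.Cl X), A = G.join (G.Im (a A)) (G.Ker (q A)) := by
    intro X A
    rw [ha, hq]; exact hj A
  have key : ∀ {X Y : C} (f : X ⟶ Y) (A : G.Cl X) (B : G.Cl Y),
      G.Rel f A B ↔ F.Rel f (τ X A) (τ Y B) := by
    intro X Y f A B
    constructor
    · intro h
      refine (EJD.rel_join_left F _ _ _ _).2 ⟨?_, ?_⟩
      · have h1 : G.Rel f (G.Im (a A)) (G.Im (a B)) := by
          rw [ha, ha]; exact κs.mono h
        rw [EJD.rel_Im, iGF, ← EJD.rel_Im] at h1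
        exact EJD.rel_trans_le F h1 (F.le_join_left _ _)
      · have h1 : G.Rel f (G.Ker (q A)) (G.Ker (q B)) := by
          rw [hq, hq]; exact κe.mono h
        rw [EJD.rel_Ker, kGF, ← EJD.rel_Ker] at h1
        exact EJD.rel_trans_le F h1 (F.le_join_right _ _)
    · intro h
      obtain ⟨h1, h2⟩ := (EJD.rel_join_left F _ _ _ _).1 h
      have h1' := (EJD.rel_join_right F hF _ _ _ _).1 h1
      have h2' := (EJD.rel_join_right F hF _ _ _ _).1 h2
      rw [hGj A, hGj B, EJD.rel_join_left]
      rw [EJD.rel_join_right G hG, EJD.rel_join_right G hG]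
      constructor
      · rw [EJD.rel_Im, ← iGF, ← EJD.rel_Im] at h1'
        exact h1'
      · exact EJD.KerIm_rel_transfer G F hF kGF iGF κe hle (fun A => ⟨_, q A, hq A⟩) hfix _ _ _ h2'
  refine ⟨fun X T => ∃ A, τ X A = T, fun X => Equiv.ofBijective
    (fun A => (⟨τ X A, A, rfl⟩ : {T : F.Cl X // ∃ A, τ X A = T})) ⟨?_, ?_⟩, ?_⟩
  · intro A B h
    have h' : τ X A = τ X B := congrArg Subtype.val h
    apply G.rel_antisymm
    · rw [key, h']; exact F.rel_id _
    · rw [key, h']; exact F.rel_id _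
  · rintro ⟨_, A, rfl⟩
    exact ⟨A, rfl⟩
  · intro X Y f A B
    exact key f A B
end

section
/- Let F be a noetherian form. The following conditions are equivalent: (i) F has a left exact decomposition; (ii) F is a strongly orean conormal form; (iii) F is a conormal form in which every largest cluster ⊤_X has a normal interior, and the direct image of every normal cluster along every morphism has a normal exterior. When F satisfies these conditions, the meet of any two normal F-clusters is normal. -/
open CategoryTheory

universe w v u

namespace NLED

variable {C : Type u} [Category.{v} C] (F : OreanForm C)

theorem le_rel {X Y : C} {f : X ⟶ Y} {A A' : F.Cl X} {B : F.Cl Y}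
    (h : F.Rel (𝟙 X) A A') (h' : F.Rel f A' B) : F.Rel f A B := by
  have := F.rel_comp h h'
  rwa [Category.id_comp] at this

theorem rel_le {X Y : C} {f : X ⟶ Y} {A : F.Cl X} {B B' : F.Cl Y}
    (h : F.Rel f A B) (h' : F.Rel (𝟙 Y) B B') : F.Rel f A B' := by
  have := F.rel_comp h h'
  rwa [Category.comp_id] at this

theorem rel_of_dimg_le {X Y : C} {f : X ⟶ Y} {A : F.Cl X} {B : F.Cl Y}
    (h : F.Rel (𝟙 Y) (F.dimg f A) B) : F.Rel f A B := rel_le F (F.rel_dimg f A) h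

theorem rel_of_le_iimg {X Y : C} {f : X ⟶ Y} {A : F.Cl X} {B : F.Cl Y}
    (h : F.Rel (𝟙 X) A (F.iimg f B)) : F.Rel f A B := le_rel F h (F.iimg_rel f B)

theorem rel_dimg_of_comp {X Y Z : C} {f : X ⟶ Y} {g : Y ⟶ Z} {A : F.Cl X} {D : F.Cl Z}
    (h : F.Rel (f ≫ g) A D) : F.Rel g (F.dimg f A) D := by
  obtain ⟨B, h1, h2⟩ := F.rel_decomp h
  exact le_rel F (F.dimg_le h1) h2

theorem rel_iimg_of_comp {X Y Z : C} {f : X ⟶ Y} {g : Y ⟶ Z} {A : F.Cl X} {D : F.Cl Z}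
    (h : F.Rel (f ≫ g) A D) : F.Rel f A (F.iimg g D) := by
  obtain ⟨B, h1, h2⟩ := F.rel_decomp h
  exact rel_le F h1 (F.le_iimg h2)

theorem isImageOf_iff {W X : C} (S : F.Cl X) (f : W ⟶ X) :
    F.toForm.IsImageOf S f ↔ F.Im f = S := by
  constructor
  · rintro ⟨t, ht, h1, h2⟩
    have : t = F.top W := F.rel_antisymm (F.le_top t) (ht _)
    subst this
    exact F.rel_antisymm (F.dimg_le h1) (h2 _ (F.rel_dimg _ _))
  · rintro rfl
    exact ⟨F.top W, F.le_top, F.rel_dimg _ _, fun T h => F.dimg_le h⟩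

theorem isKernelOf_iff {X Y : C} (S : F.Cl X) (g : X ⟶ Y) :
    F.toForm.IsKernelOf S g ↔ F.Ker g = S := by
  constructor
  · rintro ⟨b, hb, h1, h2⟩
    have : b = F.bot Y := F.rel_antisymm (hb _) (F.bot_le b)
    subst this
    exact F.rel_antisymm (h2 _ (F.iimg_rel _ _)) (F.le_iimg h1)
  · rintro rfl
    exact ⟨F.bot Y, F.bot_le, F.iimg_rel _ _, fun T h => F.le_iimg h⟩

theorem normal_bot (X : C) : F.Normal (F.bot X) :=
  ⟨X, 𝟙 X, F.rel_antisymm (F.iimg_rel _ _) (F.bot_le _)⟩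

theorem normal_iimg {X Y : C} (f : X ⟶ Y) {T : F.Cl Y} (hT : F.Normal T) :
    F.Normal (F.iimg f T) := by
  obtain ⟨Z, g, rfl⟩ := hT
  refine ⟨Z, f ≫ g, F.rel_antisymm ?_ ?_⟩
  · exact F.le_iimg (rel_iimg_of_comp F (F.iimg_rel _ _))
  · exact F.le_iimg (F.rel_comp (F.iimg_rel _ _) (F.iimg_rel _ _))

/-! Full subforms -/

section full
variable (P : ∀ X : C, F.Cl X → Prop)

theorem full_isOrean (hP : ∀ X A, P X A) : (F.toForm.Subform P).IsOrean := by
  refine ⟨fun X => ⟨⟨F.bot X, hP _ _⟩, fun A => F.bot_le A.1⟩,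
    fun X => ⟨⟨F.top X, hP _ _⟩, fun A => F.le_top A.1⟩,
    fun X A B => ⟨⟨F.join A.1 B.1, hP _ _⟩, F.le_join_left _ _, F.le_join_right _ _,
      fun D h h' => F.join_le h h'⟩,
    fun X A B => ⟨⟨F.meet A.1 B.1, hP _ _⟩, F.meet_le_left _ _, F.meet_le_right _ _,
      fun D h h' => F.le_meet h h'⟩,
    fun f S => ⟨⟨F.dimg f S.1, hP _ _⟩, F.rel_dimg _ _, fun T h => F.dimg_le h⟩,
    fun f T => ⟨⟨F.iimg f T.1, hP _ _⟩, F.iimg_rel _ _, fun T h => F.le_iimg h⟩,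
    fun f g A D h => ?_⟩
  obtain ⟨B, h1, h2⟩ := F.rel_decomp (A := A.1) (D := D.1) h
  exact ⟨⟨B, hP _ _⟩, h1, h2⟩

theorem full_isImageOf (hP : ∀ X A, P X A) {W X : C} (S : (F.toForm.Subform P).Cl X)
    (f : W ⟶ X) : (F.toForm.Subform P).IsImageOf S f ↔ F.Im f = S.1 := by
  rw [← isImageOf_iff]
  constructor
  · rintro ⟨t, ht, h1, h2⟩
    exact ⟨t.1, fun A => ht ⟨A, hP _ _⟩, h1, fun T h => h2 ⟨T, hP _ _⟩ h⟩
  · rintro ⟨t, ht, h1, h2⟩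
    exact ⟨⟨t, hP _ _⟩, fun A => ht A.1, h1, fun T h => h2 T.1 h⟩

end full

/-- kernels in a subform consisting of exactly the normal clusters, or of all clusters -/
theorem sub_isKernelOf (P : ∀ X : C, F.Cl X → Prop) (hP : ∀ X A, F.Normal A → P X A)
    {X Y : C} (S : (F.toForm.Subform P).Cl X) (g : X ⟶ Y) :
    (F.toForm.Subform P).IsKernelOf S g ↔ F.Ker g = S.1 := by
  constructor
  · rintro ⟨b, hb, h1, h2⟩
    have hb' : b.1 = F.bot Y :=
      F.rel_antisymm (hb ⟨F.bot Y, hP _ _ (normal_bot F Y)⟩) (F.bot_le _)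
    have h1' : F.Rel g S.1 (F.bot Y) := hb' ▸ (show F.Rel g S.1 b.1 from h1)
    refine F.rel_antisymm (h2 ⟨F.Ker g, hP _ _ ⟨Y, g, rfl⟩⟩ ?_) (F.le_iimg h1')
    change F.Rel g (F.Ker g) b.1
    rw [hb']
    exact F.iimg_rel _ _
  · intro h
    refine ⟨⟨F.bot Y, hP _ _ (normal_bot F Y)⟩, fun A => F.bot_le A.1, ?_, ?_⟩
    · change F.Rel g S.1 (F.bot Y)
      rw [← h]
      exact F.iimg_rel _ _
    · intro T hT
      change F.Rel _ T.1 S.1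
      rw [← h]
      exact F.le_iimg hT

/-- condition (iii) -/
def Cond3 (F : OreanForm C) : Prop :=
  F.IsConormalForm ∧
        (∀ X : C, ∃ N : F.Cl X, F.IsNormalInterior (F.top X) N) ∧
        (∀ {X Y : C} (f : X ⟶ Y) (R : F.Cl X), F.Normal R →
          ∃ E : F.Cl Y, F.IsNormalExterior (F.dimg f R) E)

theorem two_three (h : F.StronglyOrean ∧ F.IsConormalForm) : Cond3 F := by
  obtain ⟨⟨-, hO⟩, hc⟩ := h
  obtain ⟨-, ht, -, -, hd, -, -⟩ := hO
  refine ⟨hc, fun X => ?_, fun {X Y} f R hR => ?_⟩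
  · obtain ⟨t, ht⟩ := ht X
    exact ⟨t.1, t.2, F.le_top _, fun T' hT' _ => ht ⟨T', hT'⟩⟩
  · obtain ⟨T, h1, h2⟩ := hd f ⟨R, hR⟩
    exact ⟨T.1, T.2, F.dimg_le h1, fun T' hT' h => h2 ⟨T', hT'⟩ (rel_of_dimg_le F h)⟩

variable {F}

theorem three_meet (hN : F.IsNoetherian) (h : Cond3 F) {X : C} (R S : F.Cl X)
    (hR : F.Normal R) (hS : F.Normal S) : F.Normal (F.meet R S) := by
  obtain ⟨hc, -, he⟩ := h
  obtain ⟨W, m, hm⟩ := hc R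
  obtain ⟨E, hE, h1, h2⟩ := he m _ (normal_iimg F m hS)
  rw [(hN.1 m).2 S, hm] at h1 h2
  have : F.meet R S = E := by
    apply F.rel_antisymm
    · exact rel_le F (F.le_meet (F.meet_le_right _ _) (F.meet_le_left _ _)) h1
    · exact F.le_meet (h2 _ hR (F.meet_le_right _ _)) (h2 _ hS (F.meet_le_left _ _))
  rw [this]
  exact hE

theorem three_two (hN : F.IsNoetherian) (h : Cond3 F) :
    F.StronglyOrean ∧ F.IsConormalForm := by
  have hm := @three_meet _ _ _ hN h
  obtain ⟨hc, ht, he⟩ := h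
  refine ⟨⟨full_isOrean F _ (fun X A => hc A), ?_⟩, hc⟩
  refine ⟨fun X => ⟨⟨F.bot X, normal_bot F X⟩, fun A => F.bot_le A.1⟩,
    fun X => ?_,
    fun X A B => ⟨⟨F.join A.1 B.1, hN.2.2.1 _ _ A.2 B.2⟩, F.le_join_left _ _,
      F.le_join_right _ _, fun D h h' => F.join_le h h'⟩,
    fun X A B => ⟨⟨F.meet A.1 B.1, hm _ _ A.2 B.2⟩, F.meet_le_left _ _, F.meet_le_right _ _,
      fun D h h' => F.le_meet h h'⟩,
    fun f S => ?_,
    fun f T => ⟨⟨F.iimg f T.1, normal_iimg F f T.2⟩, F.iimg_rel _ _, fun T h => F.le_iimg h⟩,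
    fun f g A D h => ⟨⟨F.iimg g D.1, normal_iimg F g D.2⟩, rel_iimg_of_comp F h,
      F.iimg_rel _ _⟩⟩
  · obtain ⟨N, h1, h2, h3⟩ := ht X
    exact ⟨⟨N, h1⟩, fun A => h3 _ A.2 (F.le_top _)⟩
  · obtain ⟨E, h1, h2, h3⟩ := he f S.1 S.2
    exact ⟨⟨E, h1⟩, rel_of_dimg_le F h2, fun T h => h3 _ T.2 (F.dimg_le h)⟩

theorem one_two (h : ∃ κs κe : Operator F.toForm F.toForm,
    IsLeftDecomp F κs κe ∧ IsExact F κs κe) : F.StronglyOrean ∧ F.IsConormalForm := by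
  obtain ⟨κs, κe, ⟨⟨-, -, -, hsc, heo, hen⟩, hl⟩, -, -, hin⟩ := h
  have hfix : ∀ (X : C) (A : F.Cl X), κs.app A = A := fun X A => (hl A).symm
  have hc : F.IsConormalForm := by
    intro X S
    obtain ⟨W, f, hf⟩ := hsc X ⟨S, hfix X S⟩
    exact ⟨W, f, (full_isImageOf F _ hfix _ f).1 hf⟩
  refine ⟨⟨full_isOrean F _ (fun X A => hc A), ?_⟩, hc⟩
  have hP : (fun (X : C) (A : F.Cl X) => κe.app A = A) = fun _ S => F.Normal S := by
    funext X A
    apply propext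
    constructor
    · intro hA
      obtain ⟨Y, g, hg⟩ := hen X ⟨A, hA⟩
      exact ⟨Y, g, (isKernelOf_iff F _ _).1 (hin g _ hg)⟩
    · rintro ⟨Y, g, rfl⟩
      obtain ⟨b, hb⟩ := heo.1 Y
      obtain ⟨K, hK1, hK2⟩ := heo.2.2.2.2.2.1 g b
      have := (isKernelOf_iff F _ _).1 (hin g K ⟨b, hb, hK1, hK2⟩)
      rw [this]
      exact K.2
  change (F.toForm.Subform _).IsOrean
  rw [← hP]
  exact heo

theorem im_quotient (hN : F.IsNoetherian) {X Y : C} (e : X ⟶ Y) (K : F.Cl X)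
    (he : F.IsQuotient e K) : F.Im e = F.top Y := by
  obtain ⟨I, e', m, hq, hm, hem⟩ := hN.2.1 e
  obtain ⟨hk, hu⟩ := he
  have h1 : F.le K (F.Ker e') := by
    rw [hq.1, hk]
    exact F.rel_id _
  obtain ⟨j, hj, -⟩ := hu e' h1
  have hjm : j ≫ m = 𝟙 Y := by
    have h2 : F.le K (F.Ker e) := by
      rw [hk]
      exact F.rel_id _
    apply (hu e h2).unique
    · rw [← Category.assoc, hj, hem]
    · exact Category.comp_id _
  apply F.rel_antisymm (F.le_top _)
  rw [← hm.1, ← hjm]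
  exact F.rel_comp (rel_le F (F.rel_dimg _ _) (F.le_top _)) (F.rel_dimg m (F.top _))



theorem key (hN : F.IsNoetherian) (h : Cond3 F) (n : ∀ X : C, F.Cl X)
    (hn : ∀ X, F.IsNormalInterior (F.top X) (n X))
    {V V' X : C} (f : V ⟶ X) (f' : V' ⟶ X) (hf : F.le (F.Im f') (F.Im f)) (N : F.Cl X)
    (hr : F.Rel f (n V) N) : F.Rel f' (n V') N := by
  obtain ⟨hc, -, hE⟩ := h
  obtain ⟨W, e, m, hq, hm, hem⟩ := hN.2.1 f
  have h1 : F.Rel m (n W) N := by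
    rw [← hem] at hr
    refine le_rel F ?_ (rel_dimg_of_comp F hr)
    have h2 : F.Rel e (F.iimg e (n W)) (F.dimg e (n V)) :=
      le_rel F ((hn V).2.2 _ (normal_iimg F e (hn W).1) (F.le_top _)) (F.rel_dimg _ _)
    have h3 := F.dimg_le h2
    rw [(hN.1 e).2, im_quotient hN e _ hq] at h3
    exact rel_le F (F.le_meet (F.rel_id _) (F.le_top _)) h3
  obtain ⟨g, hg, -⟩ := hm.2 f' hf
  rw [← hg]
  obtain ⟨E, hE1, hE2, -⟩ := hE g (n V') (hn V').1
  exact F.rel_comp (rel_le F (rel_of_dimg_le F hE2) ((hn W).2.2 _ hE1 (F.le_top _))) h1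

theorem three_one (hN : F.IsNoetherian) (h : Cond3 F) :
    ∃ κs κe : Operator F.toForm F.toForm, IsLeftDecomp F κs κe ∧ IsExact F κs κe := by
  have hso := three_two hN h
  obtain ⟨hc, ht, hE⟩ := id h
  choose n hn using ht
  have hk := fun {V V' X : C} (f : V ⟶ X) (f' : V' ⟶ X) => key hN h n hn f f'
  have hex : ∀ (X : C) (A : F.Cl X), ∃ K : F.Cl X, F.Normal K ∧
      (∀ (V : C) (f : V ⟶ X), F.Im f = A → F.Rel f (n V) K) ∧
      (∀ (V : C) (f : V ⟶ X) (N : F.Cl X), F.Im f = A → F.Normal N → F.Rel f (n V) N →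
        F.Rel (𝟙 X) K N) := by
    intro X A
    obtain ⟨W, m, hm⟩ := hc A
    obtain ⟨E, h1, h2, h3⟩ := hE m (n W) (hn W).1
    refine ⟨E, h1, fun V f hf => ?_, fun V f N hf hN' hr => ?_⟩
    · refine hk m f ?_ E (rel_of_dimg_le F h2)
      rw [hf, hm]
      exact F.rel_id _
    · refine h3 N hN' (F.dimg_le (hk f m ?_ N hr))
      rw [hf, hm]
      exact F.rel_id _
  choose κ k1 k2 k3 using hex
  have hfix : ∀ (X : C) (A : F.Cl X), F.Normal A → κ X A = A := by
    intro X A hA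
    obtain ⟨W, m, hm⟩ := hc A
    have hmt : F.Rel m (F.top W) A := rel_of_dimg_le F (by
      change F.Rel _ (F.Im m) A
      rw [hm]
      exact F.rel_id _)
    apply F.rel_antisymm
    · exact k3 X A W m A hm hA (le_rel F (F.le_top _) hmt)
    · have h1 : F.Rel (𝟙 W) (F.top W) (n W) :=
        rel_le F (F.le_iimg hmt) ((hn W).2.2 _ (normal_iimg F m hA) (F.le_top _))
      have h2 : F.Rel (𝟙 X) (F.Im m) (κ X A) := F.dimg_le (le_rel F h1 (k2 X A W m hm))
      rwa [hm] at h2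
  have hmono : ∀ {X Y : C} {f : X ⟶ Y} {A : F.Cl X} {B : F.Cl Y},
      F.Rel f A B → F.Rel f (κ X A) (κ Y B) := by
    intro X Y g A B hr
    obtain ⟨V, f1, h1⟩ := hc A
    obtain ⟨W, f2, h2⟩ := hc B
    have h3 : F.le (F.Im (f1 ≫ g)) (F.Im f2) := by
      rw [h2]
      subst h1
      exact F.dimg_le (F.rel_comp (F.rel_dimg _ _) hr)
    have h4 := hk f2 (f1 ≫ g) h3 _ (k2 Y B W f2 h2)
    exact rel_of_le_iimg F
      (k3 X A V f1 _ h1 (normal_iimg F g (k1 Y B)) (rel_iimg_of_comp F h4))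
  let κe : Operator F.toForm F.toForm := ⟨fun {X} A => κ X A, hmono⟩
  have hidem : ∀ {X : C} (A : F.Cl X), κe.app (κe.app A) = κe.app A :=
    fun A => hfix _ _ (k1 _ A)
  have hP : (fun (X : C) (A : F.Cl X) => κe.app A = A) = fun _ S => F.Normal S := by
    funext X A
    apply propext
    constructor
    · intro hA
      rw [← hA]
      exact k1 _ _
    · exact hfix X A
  have heo : (F.toForm.fixedSubform κe).IsOrean := by
    unfold Form.fixedSubform
    rw [hP]
    exact hso.1.2
  have hnk : ∀ {X Y : C} (S : (F.toForm.fixedSubform κe).Cl X) (g : X ⟶ Y),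
      (F.toForm.fixedSubform κe).IsKernelOf S g ↔ F.Ker g = S.1 :=
    fun S g => sub_isKernelOf F _ hfix S g
  have hen : (F.toForm.fixedSubform κe).IsNormal := by
    intro X S
    have hS : F.Normal S.1 := by
      have := k1 X S.1
      rwa [show κ X S.1 = S.1 from S.2] at this
    obtain ⟨Y, g, hg⟩ := hS
    exact ⟨Y, g, (hnk S g).2 hg⟩
  have hss : ∀ (X : C) (A : F.Cl X), F.toForm.idOp.app A = A := fun _ _ => rfl
  have hfo : (F.toForm.fixedSubform F.toForm.idOp).IsOrean := full_isOrean F _ hss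
  have hfi : ∀ {W X : C} (S : (F.toForm.fixedSubform F.toForm.idOp).Cl X) (f : W ⟶ X),
      (F.toForm.fixedSubform F.toForm.idOp).IsImageOf S f ↔ F.Im f = S.1 :=
    fun S f => full_isImageOf F _ hss S f
  have hfk : ∀ {X Y : C} (S : (F.toForm.fixedSubform F.toForm.idOp).Cl X) (g : X ⟶ Y),
      (F.toForm.fixedSubform F.toForm.idOp).IsKernelOf S g ↔ F.Ker g = S.1 :=
    fun S g => sub_isKernelOf F _ (fun X A _ => hss X A) S g
  have hfc : (F.toForm.fixedSubform F.toForm.idOp).IsConormal := by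
    intro X S
    obtain ⟨W, f, hf⟩ := hc S.1
    exact ⟨W, f, (hfi S f).2 hf⟩
  have hei : ∀ {W X : C} (S : F.Cl X) (f : W ⟶ X), F.Im f = S →
      (F.toForm.fixedSubform κe).IsImageOf ⟨κe.app S, hidem S⟩ f := by
    intro W X S f hf
    refine ⟨⟨n W, hfix _ _ (hn W).1⟩, fun A => (hn W).2.2 _ ?_ (F.le_top _), k2 X S W f hf,
      fun T hT => k3 X S W f T.1 hf ?_ hT⟩
    · have := k1 _ A.1
      rwa [show κ _ A.1 = A.1 from A.2] at this
    · have := k1 _ T.1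
      rwa [show κ _ T.1 = T.1 from T.2] at this
  refine ⟨F.toForm.idOp, κe, ⟨⟨fun A => rfl, hidem, hfo, hfc, heo, hen⟩, fun S => rfl⟩,
    ⟨⟨⟨fun A => ⟨A, rfl⟩, fun h => h⟩, fun A => rfl, ?_, ?_⟩,
      ⟨⟨fun A => ⟨κe.app A, hidem A⟩, fun h => hmono h⟩, fun A => rfl, ?_, ?_⟩,
      hfo, hfc, heo, hen, ⟨⟨fun A => ⟨κe.app A.1, hidem A.1⟩, fun h => hmono h⟩, ?_⟩,
      ⟨⟨fun A => ⟨A.1, rfl⟩, fun h => h⟩, ?_⟩⟩, ?_, ?_⟩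
  · intro W X f S hS
    exact (hfi _ f).2 ((isImageOf_iff F S f).1 hS)
  · intro X Y g S hS
    exact (hfk _ g).2 ((isKernelOf_iff F S g).1 hS)
  · intro W X f S hS
    exact hei S f ((isImageOf_iff F S f).1 hS)
  · intro X Y g S hS
    have hS' := (isKernelOf_iff F S g).1 hS
    refine (hnk _ g).2 ?_
    change F.Ker g = κ X S
    rw [hfix X S ⟨Y, g, hS'⟩, hS']
  · intro W X f S hS
    exact hei S.1 f ((hfi S f).1 hS)
  · intro X Y g S hS
    exact (hfk _ g).2 ((hnk S g).1 hS)
  · intro W X f S hS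
    exact (isImageOf_iff F _ f).2 ((hfi S f).1 hS)
  · intro X Y g S hS
    exact (isKernelOf_iff F _ g).2 ((hnk S g).1 hS)


end NLED

/-- Theorem: for a noetherian form `F` the following are equivalent: (i) `F` has a
left exact decomposition; (ii) `F` is a strongly orean conormal form; (iii) `F` is a
conormal form in which every top cluster has a normal interior and the direct image of
every normal cluster has a normal exterior. Moreover, under these conditions, the meet
of two normal clusters is normal. -/
theorem noetherian_left_exact_decomposition {C : Type u} [Category.{v} C]
    (F : OreanForm C) (hN : F.IsNoetherian) :
    ((∃ κs κe : Operator F.toForm F.toForm, IsLeftDecomp F κs κe ∧ IsExact F κs κe) ↔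
      (F.StronglyOrean ∧ F.IsConormalForm)) ∧
    ((F.StronglyOrean ∧ F.IsConormalForm) ↔
      (F.IsConormalForm ∧
        (∀ X : C, ∃ N : F.Cl X, F.IsNormalInterior (F.top X) N) ∧
        (∀ {X Y : C} (f : X ⟶ Y) (R : F.Cl X), F.Normal R →
          ∃ E : F.Cl Y, F.IsNormalExterior (F.dimg f R) E))) ∧
    ((F.StronglyOrean ∧ F.IsConormalForm) →
      ∀ {X : C} (R S : F.Cl X), F.Normal R → F.Normal S → F.Normal (F.meet R S)) := by
  refine ⟨⟨NLED.one_two, fun h => NLED.three_one hN (NLED.two_three F h)⟩,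
    ⟨NLED.two_three F, NLED.three_two hN⟩, fun h => ?_⟩
  intro X R S hR hS
  exact NLED.three_meet hN (NLED.two_three F h) R S hR hS
end

section
/- Let F be a noetherian form. The following conditions are equivalent: (i) F has a left exact join decomposition; (ii) F is a strongly orean conormal form in which direct images of normal clusters are normal; (iii) F is a conormal form in which every largest cluster ⊤_X has a normal interior and direct images of normal clusters are normal. When F satisfies these conditions, every F-cluster that is below a normal cluster is itself normal. -/
open CategoryTheory

universe w v u

section Helpers

variable {C : Type u} [Category.{v} C]

theorem Form.rel_le {F : Form C} {X Y : C} {f : X ⟶ Y} {A : F.Cl X} {B D : F.Cl Y}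
    (h : F.Rel f A B) (h' : F.Rel (𝟙 Y) B D) : F.Rel f A D := by
  have := F.rel_comp h h'
  rwa [Category.comp_id] at this

theorem Form.le_rel {F : Form C} {X Y : C} {f : X ⟶ Y} {A A' : F.Cl X} {B : F.Cl Y}
    (h' : F.Rel (𝟙 X) A' A) (h : F.Rel f A B) : F.Rel f A' B := by
  have := F.rel_comp h' h
  rwa [Category.id_comp] at this

namespace OreanForm

theorem im_isImageOf (F : OreanForm C) {X Y : C} (f : X ⟶ Y) :
    F.toForm.IsImageOf (F.Im f) f :=
  ⟨F.top X, F.le_top, F.rel_dimg f _, fun _ h => F.dimg_le h⟩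

theorem ker_isKernelOf (F : OreanForm C) {X Y : C} (f : X ⟶ Y) :
    F.toForm.IsKernelOf (F.Ker f) f :=
  ⟨F.bot Y, F.bot_le, F.iimg_rel f _, fun _ h => F.le_iimg h⟩

theorem eq_im_of_isImageOf (F : OreanForm C) {X Y : C} {f : X ⟶ Y} {S : F.Cl Y}
    (h : F.toForm.IsImageOf S f) : F.Im f = S := by
  obtain ⟨t, ht, h1, h2⟩ := h
  have e : t = F.top X := F.rel_antisymm (F.le_top t) (ht _)
  subst e
  exact F.rel_antisymm (F.dimg_le h1) (h2 _ (F.rel_dimg f _))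

theorem eq_ker_of_isKernelOf (F : OreanForm C) {X Y : C} {f : X ⟶ Y} {S : F.Cl X}
    (h : F.toForm.IsKernelOf S f) : F.Ker f = S := by
  obtain ⟨t, ht, h1, h2⟩ := h
  have e : t = F.bot Y := F.rel_antisymm (ht _) (F.bot_le t)
  subst e
  exact F.rel_antisymm (h2 _ (F.iimg_rel f _)) (F.le_iimg h1)

theorem ker_comp (F : OreanForm C) {X Y Z : C} (f : X ⟶ Y) (g : Y ⟶ Z) :
    F.Ker (f ≫ g) = F.iimg f (F.Ker g) := by
  apply F.rel_antisymm
  · obtain ⟨B, h1, h2⟩ := F.rel_decomp (F.iimg_rel (f ≫ g) (F.bot Z))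
    exact F.le_iimg (Form.rel_le h1 (F.le_iimg h2))
  · exact F.le_iimg (F.rel_comp (F.iimg_rel f _) (F.iimg_rel g _))

theorem normal_iimg (F : OreanForm C) {X Y : C} (f : X ⟶ Y) {R : F.Cl Y} (h : F.Normal R) :
    F.Normal (F.iimg f R) := by
  obtain ⟨Z, g, rfl⟩ := h
  exact ⟨Z, f ≫ g, F.ker_comp f g⟩

theorem normal_bot (F : OreanForm C) (X : C) : F.Normal (F.bot X) :=
  ⟨X, 𝟙 X, F.rel_antisymm (F.iimg_rel _ _) (F.bot_le _)⟩

/-- Every cluster below a normal cluster is normal. -/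
theorem normal_of_le (F : OreanForm C) (hc : F.IsConormalForm)
    (hd : ∀ {X Y : C} (f : X ⟶ Y) (R : F.Cl X), F.Normal R → F.Normal (F.dimg f R))
    {X : C} {A R : F.Cl X} (hR : F.Normal R) (h : F.Rel (𝟙 X) A R) : F.Normal A := by
  obtain ⟨W, f, rfl⟩ := hc A
  apply hd
  have e : F.iimg f R = F.top W := F.rel_antisymm (F.le_top _)
    (F.le_iimg (Form.rel_le (F.rel_dimg f _) h))
  rw [← e]
  exact F.normal_iimg f hR

theorem isOrean (F : OreanForm C) : F.toForm.IsOrean :=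
  ⟨fun X => ⟨F.bot X, F.bot_le⟩, fun X => ⟨F.top X, F.le_top⟩,
    fun _ A B => ⟨F.join A B, F.le_join_left A B, F.le_join_right A B, fun _ h h' => F.join_le h h'⟩,
    fun _ A B => ⟨F.meet A B, F.meet_le_left A B, F.meet_le_right A B, fun _ h h' => F.le_meet h h'⟩,
    fun f S => ⟨F.dimg f S, F.rel_dimg f S, fun _ h => F.dimg_le h⟩,
    fun f S => ⟨F.iimg f S, F.iimg_rel f S, fun _ h => F.le_iimg h⟩,
    fun _ _ _ _ h => F.rel_decomp h⟩

/-- A subform given by a predicate that always holds is orean. -/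
theorem subform_isOrean_of_forall (F : OreanForm C) (P : ∀ X : C, F.Cl X → Prop)
    (hP : ∀ X A, P X A) : (F.toForm.Subform P).IsOrean :=
  ⟨fun X => ⟨⟨F.bot X, hP _ _⟩, fun A => F.bot_le A.1⟩,
    fun X => ⟨⟨F.top X, hP _ _⟩, fun A => F.le_top A.1⟩,
    fun _ A B => ⟨⟨F.join A.1 B.1, hP _ _⟩, F.le_join_left A.1 B.1, F.le_join_right A.1 B.1,
      fun _ h h' => F.join_le h h'⟩,
    fun _ A B => ⟨⟨F.meet A.1 B.1, hP _ _⟩, F.meet_le_left A.1 B.1, F.meet_le_right A.1 B.1,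
      fun _ h h' => F.le_meet h h'⟩,
    fun f S => ⟨⟨F.dimg f S.1, hP _ _⟩, F.rel_dimg f S.1, fun _ h => F.dimg_le h⟩,
    fun f S => ⟨⟨F.iimg f S.1, hP _ _⟩, F.iimg_rel f S.1, fun _ h => F.le_iimg h⟩,
    fun _ _ _ _ h => by
      obtain ⟨B, h1, h2⟩ := F.rel_decomp h
      exact ⟨⟨B, hP _ _⟩, h1, h2⟩⟩

/-- The normal clusters form an orean form. -/
theorem subform_isOrean_normal (F : OreanForm C) (P : ∀ X : C, F.Cl X → Prop)
    (hP : ∀ X A, P X A ↔ F.Normal A)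
    (hN3 : F.N3) (hc : F.IsConormalForm)
    (ht : ∀ X : C, ∃ N : F.Cl X, F.IsNormalInterior (F.top X) N)
    (hd : ∀ {X Y : C} (f : X ⟶ Y) (R : F.Cl X), F.Normal R → F.Normal (F.dimg f R)) :
    (F.toForm.Subform P).IsOrean := by
  refine ⟨fun X => ⟨⟨F.bot X, (hP _ _).2 (F.normal_bot X)⟩, fun A => F.bot_le A.1⟩,
    fun X => ?_,
    fun _ A B => ⟨⟨F.join A.1 B.1, (hP _ _).2 (hN3.1 _ _ ((hP _ _).1 A.2) ((hP _ _).1 B.2))⟩,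
      F.le_join_left A.1 B.1, F.le_join_right A.1 B.1, fun _ h h' => F.join_le h h'⟩,
    fun _ A B => ⟨⟨F.meet A.1 B.1, (hP _ _).2
        (F.normal_of_le hc hd ((hP _ _).1 A.2) (F.meet_le_left _ _))⟩,
      F.meet_le_left A.1 B.1, F.meet_le_right A.1 B.1, fun _ h h' => F.le_meet h h'⟩,
    fun f S => ⟨⟨F.dimg f S.1, (hP _ _).2 (hd f _ ((hP _ _).1 S.2))⟩, F.rel_dimg f S.1,
      fun _ h => F.dimg_le h⟩,
    fun f S => ⟨⟨F.iimg f S.1, (hP _ _).2 (F.normal_iimg f ((hP _ _).1 S.2))⟩, F.iimg_rel f S.1,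
      fun _ h => F.le_iimg h⟩,
    fun f _ A _ h => ?_⟩
  · obtain ⟨N, h1, _, h3⟩ := ht X
    exact ⟨⟨N, (hP _ _).2 h1⟩, fun A => h3 A.1 ((hP _ _).1 A.2) (F.le_top _)⟩
  · obtain ⟨B, h1, h2⟩ := F.rel_decomp h
    exact ⟨⟨F.dimg f A.1, (hP _ _).2 (hd f _ ((hP _ _).1 A.2))⟩, F.rel_dimg f A.1,
      Form.le_rel (F := F.toForm) (F.dimg_le h1) h2⟩

/-- In a subform of all normal clusters, kernels agree with kernels in `F`. -/
theorem subform_isKernelOf_iff (F : OreanForm C) (P : ∀ X : C, F.Cl X → Prop)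
    (hP : ∀ X A, P X A ↔ F.Normal A) {X Y : C} (g : X ⟶ Y)
    (S : (F.toForm.Subform P).Cl X) :
    (F.toForm.Subform P).IsKernelOf S g ↔ F.toForm.IsKernelOf S.1 g := by
  constructor
  · rintro ⟨b, hb, h1, h2⟩
    have e : b.1 = F.bot Y :=
      F.rel_antisymm (hb ⟨F.bot Y, (hP _ _).2 (F.normal_bot Y)⟩) (F.bot_le b.1)
    have k1 : F.Rel g S.1 b.1 := h1
    rw [e] at k1
    have k2 : F.Rel (𝟙 X) (F.Ker g) S.1 := by
      refine h2 ⟨F.Ker g, (hP _ _).2 ⟨Y, g, rfl⟩⟩ ?_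
      change F.Rel g (F.Ker g) b.1
      rw [e]
      exact F.iimg_rel g _
    have k3 : F.Ker g = S.1 := F.rel_antisymm k2 (F.le_iimg k1)
    rw [← k3]
    exact F.ker_isKernelOf g
  · intro h
    have e := F.eq_ker_of_isKernelOf h
    refine ⟨⟨F.bot Y, (hP _ _).2 (F.normal_bot Y)⟩, fun A => F.bot_le A.1, ?_, fun T hT => ?_⟩
    · change F.Rel g S.1 (F.bot Y)
      rw [← e]
      exact F.iimg_rel g _
    · change F.Rel (𝟙 X) T.1 S.1
      rw [← e]
      exact F.le_iimg hT

theorem exists_decomp (F : OreanForm C) (hN : F.IsNoetherian) (hc : F.IsConormalForm)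
    (ht : ∀ X : C, ∃ N : F.Cl X, F.IsNormalInterior (F.top X) N)
    (hd : ∀ {X Y : C} (f : X ⟶ Y) (R : F.Cl X), F.Normal R → F.Normal (F.dimg f R)) :
    ∃ κs κe : Operator F.toForm F.toForm,
        IsLeftDecomp F κs κe ∧ JoinEq F κs κe ∧ IsExact F κs κe := by
  choose N hNn _ hNm using ht
  have hle : ∀ {X : C} {A : F.Cl X}, F.Normal A → F.Rel (𝟙 X) A (N X) :=
    fun h => hNm _ _ h (F.le_top _)
  have hmn : ∀ {X : C} (A : F.Cl X), F.Normal (F.meet A (N X)) :=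
    fun A => F.normal_of_le hc hd (hNn _) (F.meet_le_right _ _)
  have hfix : ∀ {X : C} {A : F.Cl X}, F.Normal A → F.meet A (N X) = A :=
    fun h => F.rel_antisymm (F.meet_le_left _ _) (F.le_meet (F.rel_id _) (hle h))
  let κs : Operator F.toForm F.toForm := F.toForm.idOp
  let κe : Operator F.toForm F.toForm :=
    { app := fun {X} A => F.meet A (N X)
      mono := by
        intro X Y f A B h
        exact Form.rel_le (F.rel_dimg f _)
          (F.le_meet (F.dimg_le (Form.le_rel (F.meet_le_left _ _) h)) (hle (hd f _ (hmn A)))) }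
  have hPs : ∀ (X : C) (A : F.Cl X), κs.app A = A := fun _ _ => rfl
  have hPe : ∀ (X : C) (A : F.Cl X), κe.app A = A ↔ F.Normal A :=
    fun X A => ⟨fun h => h ▸ hmn A, hfix⟩
  have hOs : (F.toForm.fixedSubform κs).IsOrean := F.subform_isOrean_of_forall _ hPs
  have hOe : (F.toForm.fixedSubform κe).IsOrean :=
    F.subform_isOrean_normal _ hPe hN.2.2 hc (fun X => ⟨N X, hNn X, F.le_top _, hNm X⟩) hd
  have hker : ∀ {X Y : C} (g : X ⟶ Y) (S : (F.toForm.fixedSubform κe).Cl X),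
      (F.toForm.fixedSubform κe).IsKernelOf S g ↔ F.toForm.IsKernelOf S.1 g :=
    fun g S => F.subform_isKernelOf_iff _ hPe g S
  have hims : ∀ {X Y : C} (g : X ⟶ Y) (S : (F.toForm.fixedSubform κs).Cl Y),
      (F.toForm.fixedSubform κs).IsImageOf S g ↔ F.toForm.IsImageOf S.1 g := by
    intro X Y g S
    constructor
    · rintro ⟨t, h1, h2, h3⟩
      exact ⟨t.1, fun A => h1 ⟨A, rfl⟩, h2, fun T h => h3 ⟨T, rfl⟩ h⟩
    · rintro ⟨t, h1, h2, h3⟩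
      exact ⟨⟨t, rfl⟩, fun A => h1 A.1, h2, fun T h => h3 T.1 h⟩
  have hkers : ∀ {X Y : C} (g : X ⟶ Y) (S : (F.toForm.fixedSubform κs).Cl X),
      F.toForm.IsKernelOf S.1 g → (F.toForm.fixedSubform κs).IsKernelOf S g := by
    rintro X Y g S ⟨t, h1, h2, h3⟩
    exact ⟨⟨t, rfl⟩, fun A => h1 A.1, h2, fun T h => h3 T.1 h⟩
  have hCs : (F.toForm.fixedSubform κs).IsConormal := by
    intro X S
    obtain ⟨W, f, hf⟩ := hc S.1
    exact ⟨W, f, (hims f S).2 (hf ▸ F.im_isImageOf f)⟩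
  have hNe : (F.toForm.fixedSubform κe).IsNormal := by
    intro X S
    obtain ⟨Y, g, hg⟩ := (hPe _ _).1 S.2
    exact ⟨Y, g, (hker g S).2 (hg ▸ F.ker_isKernelOf g)⟩
  -- the image of `f` in the form of normal clusters
  have hime : ∀ {W X : C} (f : W ⟶ X) (S : F.Cl X), F.toForm.IsImageOf S f →
      ∀ S' : (F.toForm.fixedSubform κe).Cl X, S'.1 = F.meet S (N X) →
      (F.toForm.fixedSubform κe).IsImageOf S' f := by
    intro W X f S hS S' hS'
    have e := F.eq_im_of_isImageOf hS
    refine ⟨⟨N W, hfix (hNn W)⟩, fun A => hle ((hPe _ _).1 A.2), ?_, fun T hT => ?_⟩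
    · change F.Rel f (N W) S'.1
      rw [hS', ← e]
      refine Form.rel_le (F.rel_dimg f _) (F.le_meet (F.dimg_le ?_) (hle (hd f _ (hNn W))))
      exact Form.le_rel (F.le_top _) (F.rel_dimg f _)
    · change F.Rel (𝟙 X) S'.1 T.1
      have k : F.Rel (𝟙 X) (F.dimg f (F.iimg f (N X))) T.1 :=
        F.dimg_le (Form.le_rel (hle (F.normal_iimg f (hNn X))) hT)
      rw [(hN.1 f).2] at k
      rw [hS', ← e]
      exact Form.le_rel (F.le_meet (F.meet_le_right _ _) (F.meet_le_left _ _)) k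
  let τs : Operator F.toForm (F.toForm.fixedSubform κs) :=
    { app := fun A => ⟨A, rfl⟩
      mono := fun h => h }
  let τe : Operator F.toForm (F.toForm.fixedSubform κe) :=
    { app := fun A => ⟨κe.app A, hfix (hmn A)⟩
      mono := fun h => κe.mono h }
  let α : Operator (F.toForm.fixedSubform κs) (F.toForm.fixedSubform κe) :=
    { app := fun A => ⟨κe.app A.1, hfix (hmn A.1)⟩
      mono := fun h => κe.mono h }
  let β : Operator (F.toForm.fixedSubform κe) (F.toForm.fixedSubform κs) :=
    { app := fun A => ⟨A.1, rfl⟩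
      mono := fun h => h }
  refine ⟨κs, κe, ⟨⟨fun _ => rfl, fun A => hfix (hmn A), hOs, hCs, hOe, hNe⟩, fun _ => rfl⟩,
    fun S => ?_, ⟨⟨τs, fun _ => rfl, ?_, ?_⟩, ⟨τe, fun _ => rfl, ?_, ?_⟩,
      hOs, hCs, hOe, hNe, ⟨α, ?_⟩, ⟨β, ?_⟩⟩, ?_, ?_⟩
  · exact F.rel_antisymm (F.le_join_left _ _) (F.join_le (F.rel_id _) (F.meet_le_left _ _))
  · intro W X f S h
    exact (hims f _).2 h
  · intro X Y g S h
    exact hkers g _ h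
  · intro W X f S h
    exact hime f S h _ rfl
  · intro X Y g S h
    refine (hker g _).2 ?_
    have e : κe.app S = S := hfix ⟨Y, g, F.eq_ker_of_isKernelOf h⟩
    change F.toForm.IsKernelOf (κe.app S) g
    rw [e]
    exact h
  · intro W X f S h
    exact hime f S.1 ((hims f S).1 h) _ rfl
  · intro X Y g S h
    exact hkers g _ ((hker g S).1 h)
  · intro W X f S h
    exact (hims f S).1 h
  · intro X Y g S h
    exact (hker g S).1 h

theorem of_decomp (F : OreanForm C) {κs κe : Operator F.toForm F.toForm}
    (hl : IsLeftDecomp F κs κe) (hj : JoinEq F κs κe) (hx : IsExact F κs κe) :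
    F.StronglyOrean ∧ F.IsConormalForm ∧
        (∀ {X Y : C} (f : X ⟶ Y) (R : F.Cl X), F.Normal R → F.Normal (F.dimg f R)) := by
  obtain ⟨⟨_, _, _, hCs, hOe, hNe⟩, hL⟩ := hl
  obtain ⟨⟨_, ⟨τe, hτ, _, hτn⟩, _⟩, hic, hin⟩ := hx
  have hc : F.IsConormalForm := by
    intro X S
    obtain ⟨W, f, hf⟩ := hCs X ⟨S, (hL S).symm⟩
    exact ⟨W, f, F.eq_im_of_isImageOf (hic f _ hf)⟩
  have hP : ∀ {X : C} (A : F.Cl X), κe.app A = A ↔ F.Normal A := by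
    intro X A
    constructor
    · intro h
      obtain ⟨Y, g, hg⟩ := hNe X ⟨A, h⟩
      exact ⟨Y, g, F.eq_ker_of_isKernelOf (hin g _ hg)⟩
    · rintro ⟨Y, g, rfl⟩
      have k := F.eq_ker_of_isKernelOf (hin g _ (hτn g _ (F.ker_isKernelOf g)))
      rw [← hτ]
      exact k.symm
  have hn : F.normalHull.IsOrean := by
    have e : (fun (X : C) (A : F.Cl X) => κe.app A = A) = fun _ A => F.Normal A := by
      funext X A
      exact propext (hP A)
    unfold Form.fixedSubform at hOe
    rw [e] at hOe
    exact hOe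
  refine ⟨⟨F.subform_isOrean_of_forall _ fun _ S => hc S, hn⟩, hc, ?_⟩
  intro X Y f R hR
  refine (hP _).1 (F.rel_antisymm ?_ ?_)
  · have := F.le_join_right (κs.app (F.dimg f R)) (κe.app (F.dimg f R))
    rwa [← hj] at this
  · have := κe.mono (F.rel_dimg f R)
    rw [(hP R).2 hR] at this
    exact F.dimg_le this

end OreanForm

end Helpers

/-- Theorem: for a noetherian form `F` the following are equivalent: (i) `F` has a
left exact join decomposition; (ii) `F` is a strongly orean conormal form in which
direct images of normal clusters are normal; (iii) `F` is a conormal form in which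
every top cluster has a normal interior and direct images of normal clusters are
normal. Moreover, under these conditions, every cluster below a normal cluster is
normal. -/
theorem noetherian_left_exact_join_decomposition {C : Type u} [Category.{v} C]
    (F : OreanForm C) (hN : F.IsNoetherian) :
    ((∃ κs κe : Operator F.toForm F.toForm,
        IsLeftDecomp F κs κe ∧ JoinEq F κs κe ∧ IsExact F κs κe) ↔
      (F.StronglyOrean ∧ F.IsConormalForm ∧
        (∀ {X Y : C} (f : X ⟶ Y) (R : F.Cl X), F.Normal R → F.Normal (F.dimg f R)))) ∧
    ((F.StronglyOrean ∧ F.IsConormalForm ∧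
        (∀ {X Y : C} (f : X ⟶ Y) (R : F.Cl X), F.Normal R → F.Normal (F.dimg f R))) ↔
      (F.IsConormalForm ∧
        (∀ X : C, ∃ N : F.Cl X, F.IsNormalInterior (F.top X) N) ∧
        (∀ {X Y : C} (f : X ⟶ Y) (R : F.Cl X), F.Normal R → F.Normal (F.dimg f R)))) ∧
    ((F.StronglyOrean ∧ F.IsConormalForm ∧
        (∀ {X Y : C} (f : X ⟶ Y) (R : F.Cl X), F.Normal R → F.Normal (F.dimg f R))) →
      ∀ {X : C} (A R : F.Cl X), F.Normal R → F.le A R → F.Normal A) := by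
  have h23 : (F.StronglyOrean ∧ F.IsConormalForm ∧
        (∀ {X Y : C} (f : X ⟶ Y) (R : F.Cl X), F.Normal R → F.Normal (F.dimg f R))) ↔
      (F.IsConormalForm ∧
        (∀ X : C, ∃ N : F.Cl X, F.IsNormalInterior (F.top X) N) ∧
        (∀ {X Y : C} (f : X ⟶ Y) (R : F.Cl X), F.Normal R → F.Normal (F.dimg f R))) := by
    constructor
    · rintro ⟨⟨_, hn⟩, hc, hd⟩
      refine ⟨hc, fun X => ?_, hd⟩
      obtain ⟨t, ht⟩ := hn.2.1 X
      exact ⟨t.1, t.2, F.le_top _, fun T' h _ => ht ⟨T', h⟩⟩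
    · rintro ⟨hc, ht, hd⟩
      exact ⟨⟨F.subform_isOrean_of_forall _ fun _ S => hc S,
        F.subform_isOrean_normal _ (fun _ _ => Iff.rfl) hN.2.2 hc ht hd⟩, hc, hd⟩
  refine ⟨⟨?_, ?_⟩, h23, ?_⟩
  · rintro ⟨κs, κe, hl, hj, hx⟩
    exact F.of_decomp hl hj hx
  · intro h
    obtain ⟨hc, ht, hd⟩ := h23.1 h
    exact F.exists_decomp hN hc ht hd
  · rintro ⟨_, hc, hd⟩ X A R hR h
    exact F.normal_of_le hc hd hR h
end

section
/- For a strongly orean form F: the subform inclusion F_c → F is a conormal operator and the subform inclusion F_n → F is a normal operator; consequently, a morphism is an F-embedding of a conormal F-cluster if and only if it is an F_c-embedding, and a morphism is an F-quotient of a normal F-cluster if and only if it is an F_n-quotient; furthermore, F satisfies (N2) if and only if the pair (F_c, F_n) is an orean factorization. -/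
open CategoryTheory

universe w v u

namespace OreanForm

variable {C : Type u} [Category.{v} C]

theorem Im_id (F : OreanForm C) (X : C) : F.Im (𝟙 X) = F.top X :=
  F.rel_antisymm (F.le_top _) (F.rel_dimg (𝟙 X) (F.top X))

theorem Ker_id (F : OreanForm C) (X : C) : F.Ker (𝟙 X) = F.bot X :=
  F.rel_antisymm (F.iimg_rel (𝟙 X) (F.bot X)) (F.bot_le _)

theorem isImageOf_iff (F : OreanForm C) {W X : C} (S : F.Cl X) (f : W ⟶ X) :
    F.toForm.IsImageOf S f ↔ F.Im f = S := by
  constructor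
  · rintro ⟨t, ht, h1, h2⟩
    have e : t = F.top W := F.rel_antisymm (F.le_top _) (ht _)
    subst e
    exact F.rel_antisymm (F.dimg_le h1) (h2 _ (F.rel_dimg _ _))
  · rintro rfl
    exact ⟨F.top W, fun A => F.le_top A, F.rel_dimg _ _, fun T h => F.dimg_le h⟩

theorem isKernelOf_iff (F : OreanForm C) {X Y : C} (S : F.Cl X) (g : X ⟶ Y) :
    F.toForm.IsKernelOf S g ↔ F.Ker g = S := by
  constructor
  · rintro ⟨b, hb, h1, h2⟩
    have e : b = F.bot Y := F.rel_antisymm (hb _) (F.bot_le _)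
    subst e
    exact F.rel_antisymm (h2 _ (F.iimg_rel _ _)) (F.le_iimg h1)
  · rintro rfl
    exact ⟨F.bot Y, fun A => F.bot_le A, F.iimg_rel _ _, fun T h => F.le_iimg h⟩

theorem hull_isImageOf_iff (F : OreanForm C) {W X : C} (S : F.conormalHull.Cl X) (f : W ⟶ X) :
    F.conormalHull.IsImageOf S f ↔ F.Im f = S.1 := by
  constructor
  · rintro ⟨⟨t, ht'⟩, ht, h1, h2⟩
    have e : t = F.top W :=
      F.rel_antisymm (F.le_top _) (ht ⟨F.top W, W, 𝟙 W, F.Im_id W⟩)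
    subst e
    exact F.rel_antisymm (F.dimg_le h1) (h2 ⟨F.Im f, W, f, rfl⟩ (F.rel_dimg _ _))
  · obtain ⟨S, hS⟩ := S
    rintro rfl
    exact ⟨⟨F.top W, W, 𝟙 W, F.Im_id W⟩, fun A => F.le_top A.1, F.rel_dimg _ _,
      fun T h => F.dimg_le h⟩

theorem hull_isKernelOf_iff (F : OreanForm C) {X Y : C} (S : F.normalHull.Cl X) (g : X ⟶ Y) :
    F.normalHull.IsKernelOf S g ↔ F.Ker g = S.1 := by
  constructor
  · rintro ⟨⟨b, hb'⟩, hb, h1, h2⟩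
    have e : b = F.bot Y :=
      F.rel_antisymm (hb ⟨F.bot Y, Y, 𝟙 Y, F.Ker_id Y⟩) (F.bot_le _)
    subst e
    exact F.rel_antisymm (h2 ⟨F.Ker g, Y, g, rfl⟩ (F.iimg_rel _ _)) (F.le_iimg h1)
  · obtain ⟨S, hS⟩ := S
    rintro rfl
    exact ⟨⟨F.bot Y, Y, 𝟙 Y, F.Ker_id Y⟩, fun A => F.bot_le A.1, F.iimg_rel _ _,
      fun T h => F.le_iimg h⟩

theorem hull_isEmbedding_iff (F : OreanForm C) {W X : C} (m : W ⟶ X) (S : F.Cl X)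
    (hS : F.Conormal S) :
    F.IsEmbedding m S ↔ F.conormalHull.IsEmbeddingOf m ⟨S, hS⟩ := by
  constructor
  · rintro ⟨h1, h2⟩
    refine ⟨(F.hull_isImageOf_iff _ _).2 h1, fun f' S' hS' hle => h2 f' ?_⟩
    rw [(F.hull_isImageOf_iff _ _).1 hS']
    exact hle
  · rintro ⟨h1, h2⟩
    exact ⟨(F.hull_isImageOf_iff _ _).1 h1, fun f' hle =>
      h2 f' ⟨F.Im f', _, f', rfl⟩ ((F.hull_isImageOf_iff _ _).2 rfl) hle⟩

theorem hull_isQuotient_iff (F : OreanForm C) {X Y : C} (e : X ⟶ Y) (K : F.Cl X)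
    (hK : F.Normal K) :
    F.IsQuotient e K ↔ F.normalHull.IsQuotientOf e ⟨K, hK⟩ := by
  constructor
  · rintro ⟨h1, h2⟩
    refine ⟨(F.hull_isKernelOf_iff _ _).2 h1, fun g' K' hK' hle => h2 g' ?_⟩
    rw [(F.hull_isKernelOf_iff _ _).1 hK']
    exact hle
  · rintro ⟨h1, h2⟩
    exact ⟨(F.hull_isKernelOf_iff _ _).1 h1, fun g' hle =>
      h2 g' ⟨F.Ker g', _, g', rfl⟩ ((F.hull_isKernelOf_iff _ _).2 rfl) hle⟩

end OreanForm

/-- Theorem: for a strongly orean form `F`, the subform inclusion `F_c → F` is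
conormal and `F_n → F` is normal; embeddings of conormal clusters relative to `F` are
exactly `F_c`-embeddings; quotients of normal clusters relative to `F` are exactly
`F_n`-quotients; and `F` satisfies (N2) iff `(F_c, F_n)` is an orean factorization. -/
theorem strongly_orean_hulls {C : Type u} [Category.{v} C]
    (F : OreanForm C) (hSO : F.StronglyOrean) :
    F.conormalIncl.Conormal ∧ F.normalIncl.Normal ∧
    (∀ {W X : C} (m : W ⟶ X) (S : F.Cl X) (hS : F.Conormal S),
      F.IsEmbedding m S ↔ F.conormalHull.IsEmbeddingOf m ⟨S, hS⟩) ∧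
    (∀ {X Y : C} (e : X ⟶ Y) (K : F.Cl X) (hK : F.Normal K),
      F.IsQuotient e K ↔ F.normalHull.IsQuotientOf e ⟨K, hK⟩) ∧
    (F.N2 ↔ Form.IsOreanFactorization F.conormalHull F.normalHull) := by
  refine ⟨fun f S h => ?_, fun g S h => ?_, fun m S hS => F.hull_isEmbedding_iff m S hS,
    fun e K hK => F.hull_isQuotient_iff e K hK, ?_, ?_⟩
  · exact (F.isImageOf_iff _ _).2 ((F.hull_isImageOf_iff _ _).1 h)
  · exact (F.isKernelOf_iff _ _).2 ((F.hull_isKernelOf_iff _ _).1 h)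
  · intro hN
    refine ⟨hSO.1, ?_, hSO.2, ?_, ?_⟩
    · rintro X ⟨S, W, f, hf⟩
      exact ⟨W, f, (F.hull_isImageOf_iff _ _).2 hf⟩
    · rintro X ⟨S, Y, g, hg⟩
      exact ⟨Y, g, (F.hull_isKernelOf_iff _ _).2 hg⟩
    · intro X Y f
      obtain ⟨I, e, m, he, hm, hf⟩ := hN f
      exact ⟨I, e, m, ⟨F.Ker f, _, f, rfl⟩, ⟨F.Im f, _, f, rfl⟩,
        (F.hull_isKernelOf_iff _ _).2 rfl, (F.hull_isQuotient_iff _ _ _).1 he,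
        (F.hull_isImageOf_iff _ _).2 rfl, (F.hull_isEmbedding_iff _ _ _).1 hm, hf⟩
  · rintro ⟨-, -, -, -, h⟩ X Y f
    obtain ⟨I, e, m, ⟨K, hK'⟩, ⟨S, hS'⟩, hK, he, hS, hm, hf⟩ := h f
    have hK := (F.hull_isKernelOf_iff _ _).1 hK
    have hS := (F.hull_isImageOf_iff _ _).1 hS
    dsimp only at hK hS
    subst hK hS
    exact ⟨I, e, m, (F.hull_isQuotient_iff _ _ _).2 he, (F.hull_isEmbedding_iff _ _ _).2 hm, hf⟩
end
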